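/- arXiv:1503.00788 — 2 statements merged into one kernel-verified Lean document; each statement's English description precedes it below -/
import Mathlib

section
/- Assume N > 2α with N a positive integer and α ∈ (0,1). There exists a constant C > 0, depending only on N and α (one may take C = (2/(N−2α))²), such that for every u ∈ C_c^∞(ℝ^{N+1}): ∫_{ℝ^{N+1}} |y|^{1−2α} u(X)²/|X|² dX ≤ C ∫_{ℝ^{N+1}} |y|^{1−2α} |∇u(X)|² dX. -/
open MeasureTheory Metric Set Filter Topology RealInnerProductSpace

noncomputable section

/-- Euclidean space ℝ^n. -/
abbrev Euc (n : ℕ) : Type := EuclideanSpace ℝ (Fin n)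

/-- Pair `x ∈ ℝ^N` with `y ∈ ℝ` to get the point `X = (x, y)` of `ℝ^{N+1}`. -/
def pt {N : ℕ} (x : Euc N) (y : ℝ) : Euc (N + 1) :=
  (EuclideanSpace.equiv (Fin (N + 1)) ℝ).symm (Fin.snoc (EuclideanSpace.equiv (Fin N) ℝ x) y)

/-- The last coordinate (the "y" variable) of a point of `ℝ^{N+1}`. -/
def yc {N : ℕ} (X : Euc (N + 1)) : ℝ := X (Fin.last N)

/-- The first `N` coordinates (the "x" variable) of a point of `ℝ^{N+1}`. -/
def xc {N : ℕ} (X : Euc (N + 1)) : Euc N :=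
  (EuclideanSpace.equiv (Fin N) ℝ).symm (fun i => X i.castSucc)

/-- The cylinder `C_D = D × (0, ∞) ⊆ ℝ^{N+1}`. -/
def cyl {N : ℕ} (D : Set (Euc N)) : Set (Euc (N + 1)) :=
  {X | xc X ∈ D ∧ 0 < yc X}

/-- The open upper half-space `ℝ^{N+1}_+`. -/
def upperHalf (N : ℕ) : Set (Euc (N + 1)) := {X | 0 < yc X}

/-- Divergence of a vector field on `ℝ^{N+1}`. -/
def dvg {N : ℕ} (F : Euc (N + 1) → Euc (N + 1)) (X : Euc (N + 1)) : ℝ :=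
  ∑ i, fderiv ℝ F X (EuclideanSpace.single i 1) i

/-- The weighted gradient field `y^{1-2α} ∇v`. -/
def wgrad {N : ℕ} (α : ℝ) (v : Euc (N + 1) → ℝ) (X : Euc (N + 1)) : Euc (N + 1) :=
  (yc X ^ (1 - 2 * α)) • gradient v X

/-- The critical exponent `2*_α = 2N/(N - 2α)`. -/
def critExp (N : ℕ) (α : ℝ) : ℝ := 2 * N / (N - 2 * α)

/-- The weighted Dirichlet energy density `y^{1-2α} |∇v|²`. -/
def eDen {N : ℕ} (α : ℝ) (v : Euc (N + 1) → ℝ) (X : Euc (N + 1)) : ℝ :=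
  yc X ^ (1 - 2 * α) * ‖gradient v X‖ ^ 2

/-- `lim_{y→0⁺} y^{1-2α} ∂v/∂y (x, y) = L`. -/
def NeumannLim {N : ℕ} (α : ℝ) (v : Euc (N + 1) → ℝ) (x : Euc N) (L : ℝ) : Prop :=
  Tendsto (fun y : ℝ =>
      y ^ (1 - 2 * α) * fderiv ℝ v (pt x y) (EuclideanSpace.single (Fin.last N) 1))
    (nhdsWithin 0 (Set.Ioi 0)) (nhds L)

/-- A classical solution of the extension problem on `C_Ω` with exponent `p` and
parameter `lam`. -/
structure ExtSol (N : ℕ) (α lam p : ℝ) (Ω : Set (Euc N)) (v : Euc (N + 1) → ℝ) : Prop where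
  cont : ContinuousOn v (closure (cyl Ω))
  smooth : ContDiffOn ℝ 2 v (cyl Ω)
  energy : IntegrableOn (eDen α v) (cyl Ω)
  pde : ∀ X ∈ cyl Ω, dvg (wgrad α v) X = 0
  lateral : ∀ x ∈ frontier Ω, ∀ y : ℝ, 0 < y → v (pt x y) = 0
  neumann : ∀ x ∈ Ω,
    NeumannLim α v x (-(|v (pt x 0)| ^ (p - 2) * v (pt x 0) + lam * v (pt x 0)))

/-- A classical solution of the linear extension problem on `C_D` with Neumann datum `f`. -/
structure LinSol (N : ℕ) (α : ℝ) (D : Set (Euc N)) (f : Euc N → ℝ) (w : Euc (N + 1) → ℝ) :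
    Prop where
  cont : ContinuousOn w (closure (cyl D))
  smooth : ContDiffOn ℝ 2 w (cyl D)
  energy : IntegrableOn (eDen α w) (cyl D)
  pde : ∀ X ∈ cyl D, dvg (wgrad α w) X = 0
  lateral : ∀ x ∈ frontier D, ∀ y : ℝ, 0 < y → w (pt x y) = 0
  neumann : ∀ x ∈ D, NeumannLim α w x (-(f x))

/-- A finite-energy solution of the bubble problem on the half-space with coefficient `b`. -/
structure BubbleSol (N : ℕ) (α b : ℝ) (W : Euc (N + 1) → ℝ) : Prop where
  cont : ContinuousOn W {X | 0 ≤ yc X}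
  smooth : ContDiffOn ℝ 2 W (upperHalf N)
  energy : IntegrableOn (eDen α W) (upperHalf N)
  pde : ∀ X ∈ upperHalf N, dvg (wgrad α W) X = 0
  neumann : ∀ x : Euc N,
    NeumannLim α W x (-(b * (|W (pt x 0)| ^ (critExp N α - 2) * W (pt x 0))))

/-- The rescaling `ρ_{x,σ}(W)(X) = σ^{(N-2α)/2} W(σ(X - (x,0)))`. -/
def resc {N : ℕ} (α : ℝ) (x : Euc N) (σ : ℝ) (W : Euc (N + 1) → ℝ) (X : Euc (N + 1)) : ℝ :=
  σ ^ (((N : ℝ) - 2 * α) / 2) * W (σ • (X - pt x 0))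

/-- A profile decomposition of the sequence `v` with `k` bubbles. -/
structure ProfileDecomp (N : ℕ) (α lam : ℝ) (Ω : Set (Euc N)) (v : ℕ → Euc (N + 1) → ℝ)
    (v₀ : Euc (N + 1) → ℝ) (k : ℕ) (b : Fin k → ℝ) (W : Fin k → Euc (N + 1) → ℝ)
    (xb : ℕ → Fin k → Euc N) (σ : ℕ → Fin k → ℝ) : Prop where
  sol0 : ExtSol N α lam (critExp N α) Ω v₀
  beta_mem : ∀ j, b j ∈ Set.Ioc (0 : ℝ) 1
  bubble : ∀ j, BubbleSol N α (b j) (W j)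
  nontriv : ∀ j, ∃ X, 0 ≤ yc X ∧ W j X ≠ 0
  center_mem : ∀ n j, xb n j ∈ Ω
  scale_pos : ∀ n j, 0 < σ n j
  scale_dist : ∀ j, Tendsto (fun n => σ n j * Metric.infDist (xb n j) (frontier Ω)) atTop atTop
  separation : ∀ i j, i ≠ j →
    Tendsto (fun n => σ n j / σ n i + σ n i / σ n j
      + σ n i * σ n j * dist (xb n i) (xb n j) ^ 2) atTop atTop
  remainder : Tendsto (fun n => ∫ X in upperHalf N,
      eDen α (fun Z => v n Z - v₀ Z - ∑ j, resc α (xb n j) (σ n j) (W j) Z) X) atTop (nhds 0)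

/-- The mixed `(q₁, q₂, σ)` norm of `u` on `D`. -/
def mixedNorm (N : ℕ) (α : ℝ) (D : Set (Euc N)) (q₁ q₂ σ : ℝ) (u : Euc N → ℝ) : ℝ :=
  sInf {β : ℝ | 0 < β ∧ ∃ u₁ u₂ : Euc N → ℝ,
    (∀ x ∈ D, 0 ≤ u₁ x) ∧ (∀ x ∈ D, 0 ≤ u₂ x) ∧ (∀ x ∈ D, |u x| ≤ u₁ x + u₂ x) ∧
    eLpNorm u₁ (ENNReal.ofReal q₁) (volume.restrict D) ≤ ENNReal.ofReal β ∧
    eLpNorm u₂ (ENNReal.ofReal q₂) (volume.restrict D) ≤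
      ENNReal.ofReal (β * σ ^ ((N : ℝ) / critExp N α - (N : ℝ) / q₂))}


theorem lintegral_Ioi_one_rpow_neg {p : ℝ} (hp : 1 < p) :
    ∫⁻ t in Ioi (1 : ℝ), ENNReal.ofReal (t ^ (-p)) = ENNReal.ofReal (1 / (p - 1)) := by
  rw [← ofReal_integral_eq_lintegral_ofReal
    (integrableOn_Ioi_rpow_of_lt (by linarith) one_pos),
    integral_Ioi_rpow_of_lt (by linarith) one_pos]
  · rw [Real.one_rpow, neg_div, ← div_neg]
    ring_nf
  · filter_upwards [ae_restrict_mem measurableSet_Ioi] with t ht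
    exact Real.rpow_nonneg (zero_le_one.trans (le_of_lt ht)) _

open scoped ENNReal in
/-- Cauchy–Schwarz on `(1, ∞)` against the weight `t ^ s`. -/
theorem sq_lintegral_Ioi_one_le {s : ℝ} (hs : 1 < s) {g : ℝ → ℝ≥0∞} (hg : Measurable g) :
    (∫⁻ t in Ioi (1 : ℝ), g t) ^ 2 ≤
      ENNReal.ofReal (1 / (s - 1)) * ∫⁻ t in Ioi (1 : ℝ), ENNReal.ofReal (t ^ s) * g t ^ 2 := by
  have hsq : ∀ a : ℝ≥0∞, (a ^ (1 / 2 : ℝ)) ^ 2 = a := fun a => by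
    rw [← ENNReal.rpow_natCast, ← ENNReal.rpow_mul]
    norm_num
  have hpow : ∀ (q : ℝ) {t : ℝ}, 1 < t →
      ENNReal.ofReal (t ^ (q / 2)) ^ 2 = ENNReal.ofReal (t ^ q) := fun q t ht => by
    have ht0 : 0 ≤ t := by linarith
    rw [← ENNReal.ofReal_pow (Real.rpow_nonneg ht0 _), ← Real.rpow_natCast, ← Real.rpow_mul ht0]
    norm_num
  have h := ENNReal.lintegral_mul_le_Lp_mul_Lq (volume.restrict (Ioi (1 : ℝ)))
    Real.HolderConjugate.two_two
    (f := fun t => ENNReal.ofReal (t ^ (-s / 2))) (g := fun t => ENNReal.ofReal (t ^ (s / 2)) * g t)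
    (by fun_prop) (by fun_prop)
  have hL : ∫⁻ t in Ioi (1 : ℝ), ((fun t => ENNReal.ofReal (t ^ (-s / 2))) *
      fun t => ENNReal.ofReal (t ^ (s / 2)) * g t) t = ∫⁻ t in Ioi (1 : ℝ), g t := by
    refine setLIntegral_congr_fun measurableSet_Ioi fun t ht => ?_
    have ht0 : 0 < t := one_pos.trans ht
    rw [Pi.mul_apply, ← mul_assoc, ← ENNReal.ofReal_mul (Real.rpow_nonneg ht0.le _),
      ← Real.rpow_add ht0, neg_div, neg_add_cancel, Real.rpow_zero, ENNReal.ofReal_one, one_mul]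
  rw [hL] at h
  refine (pow_le_pow_left' h 2).trans_eq ?_
  rw [mul_pow, hsq, hsq, ← lintegral_Ioi_one_rpow_neg hs]
  congr 1
  · refine setLIntegral_congr_fun measurableSet_Ioi fun t ht => ?_
    rw [ENNReal.rpow_two]
    exact hpow _ ht
  · refine setLIntegral_congr_fun measurableSet_Ioi fun t ht => ?_
    rw [ENNReal.rpow_two, mul_pow, hpow _ ht]

section Homogeneous

open scoped ENNReal

variable {E : Type*} [NormedAddCommGroup E] [NormedSpace ℝ E]

/-- Integrating the radial derivative outwards along the ray through `X`. -/
theorem enorm_le_lintegral_fderiv_ray {u : E → ℝ} (hu : ContDiff ℝ 1 u) (hc : HasCompactSupport u)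
    {X : E} (hX : X ≠ 0) :
    ‖u X‖ₑ ≤ ‖X‖ₑ * ∫⁻ t in Ioi (1 : ℝ), ‖fderiv ℝ u (t • X)‖ₑ := by
  have hemb : IsClosedEmbedding fun t : ℝ => t • X := isClosedEmbedding_smul_left hX
  have hφ : ContDiff ℝ 1 fun t : ℝ => u (t • X) := hu.comp (contDiff_id.smul contDiff_const)
  have hint : ∫ t in Ioi (1 : ℝ), deriv (fun t : ℝ => u (t • X)) t = -u ((1 : ℝ) • X) :=
    (hc.comp_isClosedEmbedding hemb).integral_Ioi_deriv_eq hφ 1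
  have hderiv : ∀ t : ℝ, deriv (fun t : ℝ => u (t • X)) t = fderiv ℝ u (t • X) X := fun t => by
    have h1 : HasDerivAt (fun t : ℝ => t • X) X t := by
      simpa using (hasDerivAt_id t).smul_const X
    exact ((hu.differentiable one_ne_zero (t • X)).hasFDerivAt.comp_hasDerivAt t h1).deriv
  calc ‖u X‖ₑ = ‖∫ t in Ioi (1 : ℝ), deriv (fun t : ℝ => u (t • X)) t‖ₑ := by
        rw [hint, enorm_neg, one_smul]
    _ ≤ ∫⁻ t in Ioi (1 : ℝ), ‖deriv (fun t : ℝ => u (t • X)) t‖ₑ :=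
        enorm_integral_le_lintegral_enorm _
    _ ≤ ∫⁻ t in Ioi (1 : ℝ), ‖X‖ₑ * ‖fderiv ℝ u (t • X)‖ₑ := by
        refine lintegral_mono fun t => ?_
        rw [hderiv, mul_comm]
        exact ContinuousLinearMap.le_opENorm _ _
    _ = ‖X‖ₑ * ∫⁻ t in Ioi (1 : ℝ), ‖fderiv ℝ u (t • X)‖ₑ :=
        lintegral_const_mul' _ _ enorm_ne_top

variable [FiniteDimensional ℝ E] [MeasurableSpace E] [BorelSpace E]
  (μ : Measure E) [μ.IsAddHaarMeasure]

theorem lintegral_comp_smul_pos {f : E → ℝ≥0∞} (hf : Measurable f) {t : ℝ} (ht : 0 < t) :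
    ∫⁻ X, f (t • X) ∂μ = ENNReal.ofReal (t ^ (-(Module.finrank ℝ E : ℝ))) * ∫⁻ X, f X ∂μ := by
  rw [← lintegral_map hf (measurable_const_smul t), Measure.map_addHaar_smul μ ht.ne',
    lintegral_smul_measure, abs_of_pos (by positivity), Real.rpow_neg ht.le, Real.rpow_natCast,
    smul_eq_mul]

/-- Hardy's inequality with a weight that is positively homogeneous of degree `a`. -/
theorem lintegral_hardy_of_homogeneous [Nontrivial E] {a : ℝ} (ha : 2 < Module.finrank ℝ E + a)
    {w : E → ℝ≥0∞} (hw : Measurable w)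
    (hwt : ∀ t : ℝ, 0 < t → ∀ X, w (t • X) = ENNReal.ofReal (t ^ a) * w X)
    {u : E → ℝ} (hu : ContDiff ℝ 1 u) (hc : HasCompactSupport u) :
    ∫⁻ X, w X * (‖u X‖ₑ / ‖X‖ₑ) ^ 2 ∂μ ≤
      ENNReal.ofReal ((2 / (Module.finrank ℝ E + a - 2)) ^ 2) *
        ∫⁻ X, w X * ‖fderiv ℝ u X‖ₑ ^ 2 ∂μ := by
  set d : ℝ := (Module.finrank ℝ E : ℝ) with hd
  set s : ℝ := (d + a) / 2 with hs
  have hs1 : 1 < s := by linarith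
  have hg : Measurable fun X => ‖fderiv ℝ u X‖ₑ :=
    (hu.continuous_fderiv one_ne_zero).enorm.measurable
  set I := ∫⁻ X, w X * ‖fderiv ℝ u X‖ₑ ^ 2 ∂μ with hI
  have hscale : ∀ t : ℝ, 1 < t → ∫⁻ X, w X * (ENNReal.ofReal (t ^ s) *
      ‖fderiv ℝ u (t • X)‖ₑ ^ 2) ∂μ = ENNReal.ofReal (t ^ (-s)) * I := fun t ht => by
    have ht0 : 0 < t := by linarith
    have hX : ∀ X, w X * (ENNReal.ofReal (t ^ s) * ‖fderiv ℝ u (t • X)‖ₑ ^ 2) =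
        ENNReal.ofReal (t ^ (s - a)) * (w (t • X) * ‖fderiv ℝ u (t • X)‖ₑ ^ 2) := fun X => by
      have : ENNReal.ofReal (t ^ s) = ENNReal.ofReal (t ^ (s - a)) * ENNReal.ofReal (t ^ a) := by
        rw [← ENNReal.ofReal_mul (by positivity), ← Real.rpow_add ht0, sub_add_cancel]
      rw [hwt t ht0, this]
      ring
    simp_rw [hX]
    rw [lintegral_const_mul' _ _ ENNReal.ofReal_ne_top,
      lintegral_comp_smul_pos μ (f := fun X => w X * ‖fderiv ℝ u X‖ₑ ^ 2) (by fun_prop) ht0,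
      ← mul_assoc, ← ENNReal.ofReal_mul (by positivity), ← Real.rpow_add ht0]
    congr 3
    rw [← hd, hs]
    ring
  calc ∫⁻ X, w X * (‖u X‖ₑ / ‖X‖ₑ) ^ 2 ∂μ
      ≤ ∫⁻ X, ENNReal.ofReal (1 / (s - 1)) * (∫⁻ t in Ioi (1 : ℝ),
          w X * (ENNReal.ofReal (t ^ s) * ‖fderiv ℝ u (t • X)‖ₑ ^ 2)) ∂μ := by
        refine lintegral_mono_ae ?_
        have hne : ∀ᵐ X ∂μ, X ≠ 0 := by
          simp [ae_iff]
        filter_upwards [hne] with X hX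
        have h1 : ‖u X‖ₑ / ‖X‖ₑ ≤ ∫⁻ t in Ioi (1 : ℝ), ‖fderiv ℝ u (t • X)‖ₑ :=
          ENNReal.div_le_of_le_mul' (enorm_le_lintegral_fderiv_ray hu hc hX)
        have hm : Measurable fun t : ℝ => ‖fderiv ℝ u (t • X)‖ₑ :=
          hg.comp (measurable_id.smul_const X)
        rw [lintegral_const_mul _ (by fun_prop), mul_left_comm]
        gcongr
        exact (pow_le_pow_left' h1 2).trans (sq_lintegral_Ioi_one_le hs1 hm)
    _ = ENNReal.ofReal (1 / (s - 1)) * ∫⁻ t in Ioi (1 : ℝ), ∫⁻ X,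
          w X * (ENNReal.ofReal (t ^ s) * ‖fderiv ℝ u (t • X)‖ₑ ^ 2) ∂μ := by
        rw [lintegral_const_mul' _ _ ENNReal.ofReal_ne_top, lintegral_lintegral_swap]
        have : Measurable fun p : E × ℝ => ‖fderiv ℝ u (p.2 • p.1)‖ₑ :=
          hg.comp (measurable_snd.smul measurable_fst)
        refine Measurable.aemeasurable ?_
        simp only [Function.uncurry_def]
        fun_prop
    _ = ENNReal.ofReal (1 / (s - 1)) * (ENNReal.ofReal (1 / (s - 1)) * I) := by
        rw [setLIntegral_congr_fun measurableSet_Ioi fun t ht => hscale t ht,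
          lintegral_mul_const _ (by fun_prop), lintegral_Ioi_one_rpow_neg hs1]
    _ = ENNReal.ofReal ((2 / (d + a - 2)) ^ 2) * I := by
        rw [← mul_assoc, ← ENNReal.ofReal_mul (by rw [one_div_nonneg]; linarith)]
        congr 2
        have : d + a - 2 ≠ 0 := by linarith
        rw [show s - 1 = (d + a - 2) / 2 by rw [hs]; ring]
        field_simp

end Homogeneous

theorem locallyIntegrable_abs_rpow {a : ℝ} (ha : -1 < a) :
    LocallyIntegrable fun y : ℝ => |y| ^ a := by
  refine locallyIntegrable_of_norm_le_rpow (C := 1) (α := -a) (by simp) (by simp; linarith)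
    (ae_of_all _ fun y => ?_)
    (measurable_id.abs.pow_const a).aestronglyMeasurable
  rw [neg_neg, one_mul, Real.norm_eq_abs, Real.norm_eq_abs, abs_of_nonneg (by positivity)]

theorem integrable_abs_yc_rpow_mul {N : ℕ} {a : ℝ} (ha : -1 < a) {f : Euc (N + 1) → ℝ}
    (hf : Continuous f) (hc : HasCompactSupport f) :
    Integrable fun X : Euc (N + 1) => |yc X| ^ a * f X := by
  obtain ⟨M, hM⟩ := hf.bounded_above_of_compact_support hc
  obtain ⟨R, hR⟩ := hc.isBounded.exists_norm_le
  let h : Fin (N + 1) → ℝ → ℝ := fun i => (Icc (-R) R).indicator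
    fun y => if i = Fin.last N then |y| ^ a else 1
  have hh : ∀ i, Integrable (h i) := fun i => by
    refine IntegrableOn.integrable_indicator ?_ measurableSet_Icc
    by_cases hi : i = Fin.last N
    · simpa [hi] using (locallyIntegrable_abs_rpow ha).integrableOn_isCompact isCompact_Icc
    · simp [hi]
  have hprod : Integrable fun X : Euc (N + 1) => ∏ i, h i (X i) :=
    (PiLp.volume_preserving_ofLp (Fin (N + 1))).integrable_comp_of_integrable
      (Integrable.fintype_prod hh)
  have hyc : Measurable fun X : Euc (N + 1) => yc X := by unfold yc; fun_prop
  refine (hprod.const_mul M).mono'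
    ((hyc.abs.pow_const a).mul hf.measurable).aestronglyMeasurable (ae_of_all _ fun X => ?_)
  by_cases hX : X ∈ tsupport f
  · have hXi : ∀ i, X i ∈ Icc (-R) R := fun i =>
      abs_le.1 ((PiLp.norm_apply_le X i).trans (hR X hX))
    have : ∏ i, h i (X i) = |yc X| ^ a := by
      simp [h, hXi, yc]
    rw [this, norm_mul, mul_comm, Real.norm_of_nonneg (by positivity : 0 ≤ |yc X| ^ a)]
    gcongr
    exact hM X
  · rw [image_eq_zero_of_notMem_tsupport hX, mul_zero, norm_zero]
    have hM0 : 0 ≤ M := (norm_nonneg _).trans (hM 0)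
    refine mul_nonneg hM0 (Finset.prod_nonneg fun i _ => indicator_nonneg (fun y _ => ?_) _)
    split_ifs <;> positivity

/-- Lemma B.2, weighted Hardy inequality: for all
`u ∈ C_c^∞(ℝ^{N+1})`, `∫ |y|^{1-2α} u²/|X|² ≤ C ∫ |y|^{1-2α} |∇u|²`
(one may take `C = (2/(N-2α))²`). -/
theorem weighted_hardy_inequality
    (N : ℕ) (hNpos : 0 < N) (α : ℝ) (hα : α ∈ Set.Ioo (0 : ℝ) 1) (hN : 2 * α < (N : ℝ)) :
    ∃ C > 0, ∀ u : Euc (N + 1) → ℝ, ContDiff ℝ (⊤ : ℕ∞) u → HasCompactSupport u →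
      ∫ X : Euc (N + 1), |yc X| ^ (1 - 2 * α) * u X ^ 2 / ‖X‖ ^ 2 ≤
        C * ∫ X : Euc (N + 1), |yc X| ^ (1 - 2 * α) * ‖gradient u X‖ ^ 2 := by
  refine ⟨(2 / (N - 2 * α)) ^ 2, pow_pos (div_pos two_pos (sub_pos.2 hN)) 2, fun u hu hc => ?_⟩
  have hu1 : ContDiff ℝ 1 u := hu.of_le (by exact_mod_cast le_top)
  have hgrad : ∀ X, ‖gradient u X‖ = ‖fderiv ℝ u X‖ := fun X => LinearIsometryEquiv.norm_map _ _
  have hcd : Continuous fun X => ‖fderiv ℝ u X‖ ^ 2 :=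
    (hu1.continuous_fderiv one_ne_zero).norm.pow 2
  have hR : Integrable fun X : Euc (N + 1) => |yc X| ^ (1 - 2 * α) * ‖fderiv ℝ u X‖ ^ 2 :=
    integrable_abs_yc_rpow_mul (by linarith [hα.2]) hcd
      ((hc.fderiv (𝕜 := ℝ)).comp_left (g := fun L => ‖L‖ ^ 2) (by simp))
  have hyc : Measurable fun X : Euc (N + 1) => yc X := by unfold yc; fun_prop
  have hw : Measurable fun X : Euc (N + 1) => ENNReal.ofReal (|yc X| ^ (1 - 2 * α)) := by fun_prop
  have hmu : Measurable u := hu1.continuous.measurable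
  have hardy := lintegral_hardy_of_homogeneous (volume : Measure (Euc (N + 1)))
    (a := 1 - 2 * α) (by simp; linarith) hw (fun t ht X => by
      rw [← ENNReal.ofReal_mul (by positivity), ← Real.mul_rpow ht.le (abs_nonneg _)]
      simp [yc, abs_mul, abs_of_pos ht]) hu1 hc
  have hdim : (Module.finrank ℝ (Euc (N + 1)) : ℝ) + (1 - 2 * α) - 2 = N - 2 * α := by
    simp; ring
  rw [hdim] at hardy
  simp_rw [hgrad]
  have hL : ∫⁻ X : Euc (N + 1), ENNReal.ofReal (|yc X| ^ (1 - 2 * α) * u X ^ 2 / ‖X‖ ^ 2) ≤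
      ∫⁻ X : Euc (N + 1), ENNReal.ofReal (|yc X| ^ (1 - 2 * α)) * (‖u X‖ₑ / ‖X‖ₑ) ^ 2 := by
    refine lintegral_mono fun X => ?_
    rcases eq_or_ne X 0 with rfl | hX
    · simp
    have hX' : 0 < ‖X‖ := norm_pos_iff.2 hX
    rw [mul_div_assoc, ENNReal.ofReal_mul (by positivity), ← div_pow, ← sq_abs (u X / ‖X‖), abs_div,
      abs_norm, ENNReal.ofReal_pow (by positivity), ENNReal.ofReal_div_of_pos hX',
      Real.enorm_eq_ofReal_abs, ofReal_norm]
  have hI : ∫⁻ X : Euc (N + 1), ENNReal.ofReal (|yc X| ^ (1 - 2 * α)) * ‖fderiv ℝ u X‖ₑ ^ 2 =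
      ENNReal.ofReal (∫ X : Euc (N + 1), |yc X| ^ (1 - 2 * α) * ‖fderiv ℝ u X‖ ^ 2) := by
    rw [ofReal_integral_eq_lintegral_ofReal hR (ae_of_all _ fun X => by positivity)]
    refine lintegral_congr fun X => ?_
    rw [ENNReal.ofReal_mul (by positivity), ENNReal.ofReal_pow (norm_nonneg _), ofReal_norm]
  rw [integral_eq_lintegral_of_nonneg_ae (ae_of_all _ fun X => by positivity)
    (by
      have h : Measurable fun X : Euc (N + 1) => |yc X| ^ (1 - 2 * α) * u X ^ 2 / ‖X‖ ^ 2 := by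
        fun_prop
      exact h.aestronglyMeasurable)]
  refine ENNReal.toReal_le_of_le_ofReal
    (mul_nonneg (sq_nonneg _) (integral_nonneg fun X => by positivity)) ?_
  rw [ENNReal.ofReal_mul (sq_nonneg _), ← hI]
  exact hL.trans hardy

end
end

section
/- Let v be C² on ℝ^{N+1}_+ and continuous on the closed half-space, satisfying div(y^{1−2α}∇v) = 0 pointwise in ℝ^{N+1}_+ and, for every x ∈ ℝ^N, lim_{y→0⁺} y^{1−2α} ∂v/∂y(x,y) = −|v(x,0)|^{2*_α−2} v(x,0). Define the Kelvin transform ṽ(X) = |X|^{−(N−2α)} v(X/|X|²) for X ≠ 0. Then ṽ satisfies div(y^{1−2α}∇ṽ) = 0 pointwise in ℝ^{N+1}_+ \ {0} and, for every x ∈ ℝ^N \ {0}, lim_{y→0⁺} y^{1−2α} ∂ṽ/∂y(x,y) = −|ṽ(x,0)|^{2*_α−2} ṽ(x,0). -/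
open MeasureTheory Metric Set Filter Topology RealInnerProductSpace

noncomputable section

/-- The Kelvin transform `ṽ(X) = |X|^{-(N-2α)} v(X/|X|²)`. -/
def kelvin (N : ℕ) (α : ℝ) (v : Euc (N + 1) → ℝ) : Euc (N + 1) → ℝ :=
  fun X => ‖X‖ ^ (-((N : ℝ) - 2 * α)) * v ((‖X‖ ^ 2)⁻¹ • X)

/-- The `i`-th coordinate vector. -/
abbrev bv {n : ℕ} (i : Fin n) : Euc n := EuclideanSpace.single i (1 : ℝ)

/-- The non-divergence form `Δv + ((1-2α)/y) ∂_y v` of the weighted operator. -/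
def wlap {N : ℕ} (α : ℝ) (v : Euc (N + 1) → ℝ) (X : Euc (N + 1)) : ℝ :=
  ∑ i, fderiv ℝ (fderiv ℝ v) X (bv i) (bv i)
    + (1 - 2 * α) / yc X * fderiv ℝ v X (bv (Fin.last N))

section Calculus

variable {E : Type*} [NormedAddCommGroup E] [NormedSpace ℝ E]

theorem hasDerivAt_comp_line {F : Type*} [NormedAddCommGroup F] [NormedSpace ℝ F]
    {f : E → F} {X e : E} {t : ℝ} (h : DifferentiableAt ℝ f (X + t • e)) :
    HasDerivAt (fun t : ℝ => f (X + t • e)) (fderiv ℝ f (X + t • e) e) t := by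
  have h1 : HasDerivAt (fun t : ℝ => X + t • e) e t := by
    simpa using ((hasDerivAt_id t).smul_const e).const_add X
  exact h.hasFDerivAt.comp_hasDerivAt t h1

theorem tendsto_line (X e : E) : Tendsto (fun t : ℝ => X + t • e) (𝓝 0) (𝓝 X) := by
  have : Continuous (fun t : ℝ => X + t • e) := by fun_prop
  simpa using this.tendsto 0

theorem eventually_hasDerivAt_comp_line {f : E → ℝ} {X : E} (h : ContDiffAt ℝ 2 f X) (e : E) :
    ∀ᶠ t in 𝓝 (0 : ℝ), HasDerivAt (fun t : ℝ => f (X + t • e)) (fderiv ℝ f (X + t • e) e) t := by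
  have h1 : ∀ᶠ Z in 𝓝 X, ContDiffAt ℝ 2 f Z := h.eventually (by simp)
  filter_upwards [(tendsto_line X e).eventually h1] with t ht
  exact hasDerivAt_comp_line (ht.differentiableAt (by simp))

theorem ContDiffAt.differentiableAt_fderiv_two {f : E → ℝ} {X : E} (h : ContDiffAt ℝ 2 f X) :
    DifferentiableAt ℝ (fderiv ℝ f) X :=
  (h.fderiv_right (m := 1) (by norm_num)).differentiableAt (by simp)

theorem hasDerivAt_fderiv_line {f : E → ℝ} {X : E} (h : ContDiffAt ℝ 2 f X) (e : E) :
    HasDerivAt (fun t : ℝ => fderiv ℝ f (X + t • e) e) (fderiv ℝ (fderiv ℝ f) X e e) 0 := by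
  have h1 : DifferentiableAt ℝ (fderiv ℝ f) (X + (0 : ℝ) • e) := by
    simpa using h.differentiableAt_fderiv_two
  have h2 := (hasDerivAt_comp_line h1).clm_apply (hasDerivAt_const (0 : ℝ) e)
  simpa using h2

/-- Second derivatives along a line determine the diagonal Hessian entries. -/
theorem fderiv_fderiv_eq_of_line {f : E → ℝ} {X e : E} (h : ContDiffAt ℝ 2 f X)
    {k' : ℝ → ℝ} {c : ℝ} (h1 : ∀ᶠ t in 𝓝 (0 : ℝ), HasDerivAt (fun t : ℝ => f (X + t • e)) (k' t) t)
    (h2 : HasDerivAt k' c 0) : fderiv ℝ (fderiv ℝ f) X e e = c := by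
  have h3 : (fun t : ℝ => fderiv ℝ f (X + t • e) e) =ᶠ[𝓝 0] k' := by
    filter_upwards [h1, eventually_hasDerivAt_comp_line h e] with t ht ht'
    exact ht'.unique ht
  exact (hasDerivAt_fderiv_line h e).unique (h2.congr_of_eventuallyEq h3)

theorem second_deriv_nonpos_of_isLocalMax {g g' : ℝ → ℝ} {c : ℝ}
    (h1 : ∀ᶠ t in 𝓝 (0 : ℝ), HasDerivAt g (g' t) t) (h2 : HasDerivAt g' c 0)
    (hmax : IsLocalMax g 0) : c ≤ 0 := by
  by_contra! hc
  have hd : deriv g =ᶠ[𝓝 0] g' := h1.mono fun t ht => ht.deriv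
  have hdd : deriv (deriv g) 0 = c := by rw [hd.deriv_eq, h2.deriv]
  have hmin : IsLocalMin g 0 := isLocalMin_of_deriv_deriv_pos (by rw [hdd]; exact hc)
    hmax.deriv_eq_zero h1.self_of_nhds.continuousAt
  have hconst : g =ᶠ[𝓝 0] fun _ => g 0 := by
    filter_upwards [hmax, hmin] with t h h' using le_antisymm h h'
  have h0 : g' =ᶠ[𝓝 0] fun _ => 0 := by
    filter_upwards [hconst.eventuallyEq_nhds, h1] with t ht ht'
    rw [← ht'.deriv, ht.deriv_eq, deriv_const]
  have := (h2.congr_of_eventuallyEq h0.symm).unique (hasDerivAt_const (0 : ℝ) (0 : ℝ))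
  exact hc.ne' this

theorem hasDerivAt_le_of_le_mul {g : ℝ → ℝ} {d C r : ℝ} (hr : 0 < r) (hg : HasDerivAt g d 0)
    (h0 : g 0 = 0) (hle : ∀ t ∈ Ioo 0 r, g t ≤ C * t) : d ≤ C := by
  have h1 := (hasDerivWithinAt_iff_tendsto_slope' (s := Ioi 0) (by simp)).1 hg.hasDerivWithinAt
  refine le_of_tendsto h1 ?_
  filter_upwards [Ioo_mem_nhdsGT hr] with t ht
  rw [slope_def_field, h0, sub_zero, sub_zero, div_le_iff₀ ht.1]
  exact hle t ht

/-- A function on `[0, r]` with positive weighted derivative at `0⁺` is not maximal at `0`. -/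
theorem not_max_of_weighted_deriv_pos {g g' : ℝ → ℝ} {a l r : ℝ} (hr : 0 < r)
    (hc : ContinuousOn g (Ico 0 r)) (hd : ∀ t ∈ Ioo 0 r, HasDerivAt g (g' t) t)
    (hl : Tendsto (fun t => t ^ a * g' t) (𝓝[>] 0) (𝓝 l)) (hpos : 0 < l)
    (hmax : ∀ t ∈ Ico 0 r, g t ≤ g 0) : False := by
  have h1 := hl.eventually (lt_mem_nhds hpos)
  obtain ⟨δ, hδ, hδ'⟩ := mem_nhdsGT_iff_exists_Ioo_subset.1 (h1.and (Ioo_mem_nhdsGT hr))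
  have hδ0 : 0 < δ := hδ
  have hmono : StrictMonoOn g (Icc 0 (δ / 2)) := by
    refine strictMonoOn_of_deriv_pos (convex_Icc _ _) (hc.mono ?_) ?_
    · intro t ht
      refine ⟨ht.1, ?_⟩
      have h3 : δ / 2 ∈ Ioo 0 δ := ⟨by linarith, by linarith⟩
      have := (hδ' h3).2.2
      linarith [ht.2]
    · intro t ht
      rw [interior_Icc] at ht
      have h3 := hδ' (show t ∈ Ioo 0 δ from ⟨ht.1, by linarith [ht.2]⟩)
      rw [(hd t h3.2).deriv]
      exact pos_of_mul_pos_right h3.1 (Real.rpow_nonneg ht.1.le _)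
  have h3 : δ / 2 ∈ Ioo 0 δ := ⟨by linarith, by linarith⟩
  have h4 := hmono ⟨le_rfl, h3.1.le⟩ ⟨h3.1.le, le_rfl⟩ h3.1
  have h5 := (hδ' h3).2
  exact absurd (hmax _ ⟨h5.1.le, h5.2⟩) (not_le.2 h4)

end Calculus

theorem isCompact_box {n : ℕ} (l u : Fin n → ℝ) :
    IsCompact {X : Euc n | ∀ i, X i ∈ Icc (l i) (u i)} := by
  have h := (EuclideanSpace.equiv (Fin n) ℝ).toHomeomorph.isCompact_preimage.2
    (isCompact_univ_pi fun i => isCompact_Icc (a := l i) (b := u i))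
  convert h using 1
  ext X
  exact Set.mem_univ_pi.symm

theorem isOpen_upperHalf (N : ℕ) : IsOpen (upperHalf N) :=
  isOpen_lt continuous_const (by unfold yc; fun_prop)

theorem dvg_wgrad_eq {N : ℕ} (α : ℝ) {v : Euc (N + 1) → ℝ} {X : Euc (N + 1)}
    (hv : ContDiffAt ℝ 2 v X) (hX : 0 < yc X) :
    dvg (wgrad α v) X = yc X ^ (1 - 2 * α) * wlap α v X := by
  have hy : HasFDerivAt (fun Z : Euc (N + 1) => yc Z ^ (1 - 2 * α))
      (((1 - 2 * α) * yc X ^ (1 - 2 * α - 1)) •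
        (EuclideanSpace.proj (Fin.last N) : Euc (N + 1) →L[ℝ] ℝ)) X :=
    ((EuclideanSpace.proj (𝕜 := ℝ) (Fin.last N)).hasFDerivAt (x := X)).rpow_const
      (Or.inl hX.ne')
  have hH := hv.differentiableAt_fderiv_two
  have hgr : DifferentiableAt ℝ (gradient v) X :=
    ((InnerProductSpace.toDual ℝ
      (Euc (N + 1))).symm.toContinuousLinearEquiv.toContinuousLinearMap.differentiableAt).comp X hH
  have hF : DifferentiableAt ℝ (wgrad α v) X := hy.differentiableAt.smul hgr
  have hco : ∀ i (Z : Euc (N + 1)), wgrad α v Z i = yc Z ^ (1 - 2 * α) * fderiv ℝ v Z (bv i) := by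
    intro i Z
    have : gradient v Z i = fderiv ℝ v Z (bv i) := by
      have h := InnerProductSpace.toDual_symm_apply (𝕜 := ℝ) (x := bv i) (y := fderiv ℝ v Z)
      rw [← h, bv, EuclideanSpace.inner_single_right]
      simp [gradient]
    simp [wgrad, this]
  have key : ∀ i, fderiv ℝ (wgrad α v) X (EuclideanSpace.single i 1) i =
      yc X ^ (1 - 2 * α) * fderiv ℝ (fderiv ℝ v) X (bv i) (bv i) +
      (1 - 2 * α) * yc X ^ (1 - 2 * α - 1) *
        (bv i : Euc (N + 1)) (Fin.last N) * fderiv ℝ v X (bv i) := by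
    intro i
    have h1 := ((EuclideanSpace.proj i : Euc (N + 1) →L[ℝ] ℝ).hasFDerivAt
      (x := wgrad α v X)).comp X hF.hasFDerivAt
    have h2 := hy.mul (hH.hasFDerivAt.clm_apply (hasFDerivAt_const (bv i) X))
    have h3 : (⇑(EuclideanSpace.proj i : Euc (N + 1) →L[ℝ] ℝ)) ∘ wgrad α v =
      fun Z => yc Z ^ (1 - 2 * α) * fderiv ℝ v Z (bv i) := by
      funext Z; exact hco i Z
    rw [h3] at h1
    have h4 := congrArg (fun T => T (bv i)) (h1.unique h2)
    simp only [ContinuousLinearMap.comp_apply] at h4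
    refine Eq.trans ?_ (h4.trans ?_)
    · rfl
    · simp
      ring_nf
  have hsum : ∑ i : Fin (N + 1), (1 - 2 * α) * yc X ^ (1 - 2 * α - 1) *
      (bv i : Euc (N + 1)) (Fin.last N) * fderiv ℝ v X (bv i) =
      (1 - 2 * α) * yc X ^ (1 - 2 * α - 1) * fderiv ℝ v X (bv (Fin.last N)) := by
    rw [Finset.sum_eq_single (Fin.last N)]
    · simp
    · intro i _ hi
      have h0 : (bv i : Euc (N + 1)) (Fin.last N) = 0 := by simp [hi.symm]
      rw [h0]
      ring
    · exact fun h => absurd (Finset.mem_univ _) h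
  unfold dvg wlap
  rw [Finset.sum_congr rfl fun i _ => key i, Finset.sum_add_distrib, ← Finset.mul_sum, hsum,
    Real.rpow_sub_one hX.ne']
  ring

theorem sum_smul_bv {n : ℕ} (X : Euc n) : ∑ i, X i • bv i = X := by
  simpa using (EuclideanSpace.basisFun (Fin n) ℝ).sum_repr X

theorem map_eq_sum_bv {n : ℕ} {F : Type*} [NormedAddCommGroup F] [NormedSpace ℝ F]
    (T : Euc n →L[ℝ] F) (X : Euc n) : T X = ∑ i, X i • T (bv i) := by
  conv_lhs => rw [← sum_smul_bv X]
  simp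

theorem norm_sq_add_smul_bv {n : ℕ} (X : Euc n) (i : Fin n) (t : ℝ) :
    ‖X + t • bv i‖ ^ 2 = ‖X‖ ^ 2 + 2 * X i * t + t ^ 2 := by
  rw [norm_add_sq_real, norm_smul, inner_smul_right, EuclideanSpace.inner_single_right]
  simp
  ring

theorem kelvin_eq {N : ℕ} (α : ℝ) (v : Euc (N + 1) → ℝ) (X : Euc (N + 1)) :
    kelvin N α v X = (‖X‖ ^ 2) ^ (-((N : ℝ) - 2 * α) / 2) * v ((‖X‖ ^ 2)⁻¹ • X) := by
  rw [kelvin, ← Real.rpow_natCast, ← Real.rpow_mul (norm_nonneg X)]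
  congr 2
  push_cast
  ring

theorem ne_zero_of_yc_pos {N : ℕ} {X : Euc (N + 1)} (h : 0 < yc X) : X ≠ 0 := by
  rintro rfl
  simp [yc] at h

/-- First derivative of the Kelvin transform along a coordinate line. -/
theorem hasDerivAt_kelvin_line {N : ℕ} (α : ℝ) {v : Euc (N + 1) → ℝ} (X : Euc (N + 1))
    (i : Fin (N + 1)) {t n x P m : ℝ} (hn : n = ‖X + t • bv i‖ ^ 2) (hn0 : 0 < n)
    (hx : x = X i + t) (hm : m = (N : ℝ) - 2 * α) (hP : P = n ^ (-m / 2))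
    (hv : DifferentiableAt ℝ v (n⁻¹ • (X + t • bv i))) :
    HasDerivAt (fun t : ℝ => kelvin N α v (X + t • bv i))
      (-m * x * (P / n) * v (n⁻¹ • (X + t • bv i)) +
        P * fderiv ℝ v (n⁻¹ • (X + t • bv i))
          (n⁻¹ • bv i - (2 * x / n ^ 2) • (X + t • bv i))) t := by
  have hN : HasDerivAt (fun t : ℝ => ‖X + t • bv i‖ ^ 2) (2 * x) t := by
    simp_rw [norm_sq_add_smul_bv]
    have := (((hasDerivAt_id t).const_mul (2 * X i)).const_add (‖X‖ ^ 2)).add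
      ((hasDerivAt_id t).pow 2)
    refine (this.congr_deriv ?_)
    simp [hx]
    ring
  have hl : HasDerivAt (fun t : ℝ => X + t • bv i) (bv i) t := by
    simpa using ((hasDerivAt_id t).smul_const (bv i)).const_add X
  have hp := hN.rpow_const (p := -m / 2) (Or.inl (by rw [← hn]; exact hn0.ne'))
  have hc := (hN.inv (by rw [← hn]; exact hn0.ne')).smul hl
  have hv' : HasFDerivAt v (fderiv ℝ v (n⁻¹ • (X + t • bv i)))
      ((‖X + t • bv i‖ ^ 2)⁻¹ • (X + t • bv i)) := by
    rw [← hn]; exact hv.hasFDerivAt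
  have hvc := hv'.comp_hasDerivAt t hc
  have h := hp.mul hvc
  have heq : (fun t : ℝ => kelvin N α v (X + t • bv i)) =
      (fun t : ℝ => (‖X + t • bv i‖ ^ 2) ^ (-m / 2)) *
        (v ∘ fun t : ℝ => (‖X + t • bv i‖ ^ 2)⁻¹ • (X + t • bv i)) := by
    funext s
    simp only [kelvin_eq, Pi.mul_apply, Function.comp_apply, hm]
  rw [heq]
  refine h.congr_deriv ?_
  simp only [Function.comp_apply, Pi.inv_apply, Pi.smul_apply', ← hn]
  rw [Real.rpow_sub_one hn0.ne', ← hP]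
  congr 1
  · ring
  · congr 2
    rw [sub_eq_add_neg, ← neg_smul]
    congr 2
    ring

theorem fderiv_kelvin {N : ℕ} (α : ℝ) {v : Euc (N + 1) → ℝ} (X : Euc (N + 1))
    (i : Fin (N + 1)) {n P m : ℝ} (hn : n = ‖X‖ ^ 2) (hn0 : 0 < n)
    (hm : m = (N : ℝ) - 2 * α) (hP : P = n ^ (-m / 2)) (hk : DifferentiableAt ℝ (kelvin N α v) X)
    (hv : DifferentiableAt ℝ v (n⁻¹ • X)) :
    fderiv ℝ (kelvin N α v) X (bv i) =
      -m * X i * (P / n) * v (n⁻¹ • X) +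
        P * fderiv ℝ v (n⁻¹ • X) (n⁻¹ • bv i - (2 * X i / n ^ 2) • X) := by
  have h0 : X + (0 : ℝ) • bv i = X := by simp
  have h1 := hasDerivAt_kelvin_line (t := 0) α X i (by rw [h0]; exact hn) hn0
    (add_zero _).symm hm hP (by rw [h0]; exact hv)
  rw [h0] at h1
  have h2 := hasDerivAt_comp_line (f := kelvin N α v) (X := X) (e := bv i) (t := 0)
    (by rw [h0]; exact hk)
  rw [h0] at h2
  exact h2.unique h1

theorem contDiffAt_kelvin {N : ℕ} (α : ℝ) {v : Euc (N + 1) → ℝ} {X : Euc (N + 1)}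
    (hX : X ≠ 0) (hv : ContDiffAt ℝ 2 v ((‖X‖ ^ 2)⁻¹ • X)) :
    ContDiffAt ℝ 2 (kelvin N α v) X := by
  have hn : ContDiffAt ℝ 2 (fun Z : Euc (N + 1) => ‖Z‖ ^ 2) X := (contDiff_norm_sq ℝ).contDiffAt
  have hn0 : ‖X‖ ^ 2 ≠ 0 := by positivity
  have hc : ContDiffAt ℝ 2 (fun Z : Euc (N + 1) => (‖Z‖ ^ 2)⁻¹ • Z) X :=
    (hn.inv hn0).smul contDiffAt_id
  have hvc : ContDiffAt ℝ 2 (v ∘ fun Z : Euc (N + 1) => (‖Z‖ ^ 2)⁻¹ • Z) X :=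
    ContDiffAt.comp X (g := v) hv hc
  have h := (hn.rpow_const_of_ne (p := -((N : ℝ) - 2 * α) / 2) hn0).mul hvc
  have heq : kelvin N α v = fun Z => (‖Z‖ ^ 2) ^ (-((N : ℝ) - 2 * α) / 2) *
      (v ∘ fun Z : Euc (N + 1) => (‖Z‖ ^ 2)⁻¹ • Z) Z := funext fun Z => kelvin_eq α v Z
  rw [heq]
  exact h

theorem hasDerivAt_kelvin_line_deriv {E : Type*} [NormedAddCommGroup E] [NormedSpace ℝ E]
    {v : E → ℝ} {ν : ℝ → ℝ} {l : ℝ → E} {e X : E} {x n m P : ℝ} (hν : HasDerivAt ν (2 * x) 0)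
    (hl : HasDerivAt l e 0) (hν0 : ν 0 = n) (hl0 : l 0 = X) (hn0 : 0 < n)
    (hP : P = n ^ (-m / 2)) (hv : ContDiffAt ℝ 2 v (n⁻¹ • X)) :
    HasDerivAt (fun t => -m * (x + t) * (ν t ^ (-m / 2) / ν t) * v ((ν t)⁻¹ • l t) +
        ν t ^ (-m / 2) * fderiv ℝ v ((ν t)⁻¹ • l t)
          ((ν t)⁻¹ • e - (2 * (x + t) / ν t ^ 2) • l t))
      ((-m * (P / n) + m * (m + 2) * x ^ 2 * (P / n ^ 2)) * v (n⁻¹ • X) +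
      2 * (-m * x * (P / n)) * fderiv ℝ v (n⁻¹ • X) (n⁻¹ • e - (2 * x / n ^ 2) • X) +
      P * (fderiv ℝ (fderiv ℝ v) (n⁻¹ • X) (n⁻¹ • e - (2 * x / n ^ 2) • X)
          (n⁻¹ • e - (2 * x / n ^ 2) • X) +
        fderiv ℝ v (n⁻¹ • X)
          ((-4 * x / n ^ 2) • e + (8 * x ^ 2 / n ^ 3 - 2 / n ^ 2) • X))) 0 := by
  have hne : ν 0 ≠ 0 := by rw [hν0]; exact hn0.ne'
  have hc : HasDerivAt (fun t => (ν t)⁻¹ • l t) (n⁻¹ • e - (2 * x / n ^ 2) • X) 0 := by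
    refine ((hν.inv hne).smul hl).congr_deriv ?_
    simp only [Pi.inv_apply, hν0, hl0]
    module
  have hx : HasDerivAt (fun t : ℝ => x + t) 1 0 := by
    simpa using (hasDerivAt_id (0 : ℝ)).const_add x
  have hp : HasDerivAt (fun t => ν t ^ (-m / 2)) (-m * x * (P / n)) 0 := by
    refine (hν.rpow_const (p := -m / 2) (Or.inl hne)).congr_deriv ?_
    rw [hν0, Real.rpow_sub_one hn0.ne', ← hP]
    ring
  have hc' : HasDerivAt (fun t => (ν t)⁻¹ • e - (2 * (x + t) / ν t ^ 2) • l t)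
      ((-4 * x / n ^ 2) • e + (8 * x ^ 2 / n ^ 3 - 2 / n ^ 2) • X) 0 := by
    refine (((hν.inv hne).smul_const e).sub
      (((hx.const_mul 2).div (hν.pow 2) (pow_ne_zero 2 hne)).smul hl)).congr_deriv ?_
    simp only [Pi.div_apply, Pi.pow_apply, hν0, hl0, add_zero]
    match_scalars
    · ring
    · field_simp
      push_cast
      ring
  have hq : HasDerivAt (fun t => -m * (x + t) * (ν t ^ (-m / 2) / ν t))
      (-m * (P / n) + m * (m + 2) * x ^ 2 * (P / n ^ 2)) 0 := by
    refine ((hx.const_mul (-m)).mul (hp.div hν hne)).congr_deriv ?_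
    simp only [Pi.div_apply, hν0, ← hP, add_zero]
    field_simp
    ring
  have hv' : HasFDerivAt v (fderiv ℝ v (n⁻¹ • X)) ((ν 0)⁻¹ • l 0) := by
    rw [hν0, hl0]; exact (hv.differentiableAt (by simp)).hasFDerivAt
  have hDv' : HasFDerivAt (fderiv ℝ v) (fderiv ℝ (fderiv ℝ v) (n⁻¹ • X)) ((ν 0)⁻¹ • l 0) := by
    rw [hν0, hl0]; exact hv.differentiableAt_fderiv_two.hasFDerivAt
  have hvc : HasDerivAt (fun t => v ((ν t)⁻¹ • l t)) _ 0 := hv'.comp_hasDerivAt 0 hc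
  have hDvc : HasDerivAt (fun t => fderiv ℝ v ((ν t)⁻¹ • l t)) _ 0 := hDv'.comp_hasDerivAt 0 hc
  refine ((hq.mul hvc).add (hp.mul (hDvc.clm_apply hc'))).congr_deriv ?_
  simp only [hν0, hl0, add_zero, ← hP]
  ring

/-- Diagonal second derivatives of the Kelvin transform. -/
theorem fderiv_fderiv_kelvin {N : ℕ} (α : ℝ) {v : Euc (N + 1) → ℝ} (X : Euc (N + 1))
    (i : Fin (N + 1)) {n P m : ℝ} (hn : n = ‖X‖ ^ 2) (hn0 : 0 < n)
    (hm : m = (N : ℝ) - 2 * α) (hP : P = n ^ (-m / 2)) (hv : ContDiffAt ℝ 2 v (n⁻¹ • X)) :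
    fderiv ℝ (fderiv ℝ (kelvin N α v)) X (bv i) (bv i) =
      (-m * (P / n) + m * (m + 2) * X i ^ 2 * (P / n ^ 2)) * v (n⁻¹ • X) +
      2 * (-m * X i * (P / n)) * fderiv ℝ v (n⁻¹ • X) (n⁻¹ • bv i - (2 * X i / n ^ 2) • X) +
      P * (fderiv ℝ (fderiv ℝ v) (n⁻¹ • X) (n⁻¹ • bv i - (2 * X i / n ^ 2) • X)
          (n⁻¹ • bv i - (2 * X i / n ^ 2) • X) +
        fderiv ℝ v (n⁻¹ • X)
          ((-4 * X i / n ^ 2) • bv i + (8 * X i ^ 2 / n ^ 3 - 2 / n ^ 2) • X)) := by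
  have hX : X ≠ 0 := by
    rintro rfl
    simp [hn] at hn0
  have hk := contDiffAt_kelvin α hX (by rw [← hn]; exact hv)
  have h0 : X + (0 : ℝ) • bv i = X := by simp
  have hl : HasDerivAt (fun t : ℝ => X + t • bv i) (bv i) 0 := by
    simpa using ((hasDerivAt_id (0 : ℝ)).smul_const (bv i)).const_add X
  have hN : HasDerivAt (fun t : ℝ => ‖X + t • bv i‖ ^ 2) (2 * X i) 0 := by
    simp_rw [norm_sq_add_smul_bv]
    refine ((((hasDerivAt_id (0 : ℝ)).const_mul (2 * X i)).const_add (‖X‖ ^ 2)).add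
      ((hasDerivAt_id (0 : ℝ)).pow 2)).congr_deriv ?_
    simp
  have hn1 : ‖X + (0 : ℝ) • bv i‖ ^ 2 = n := by rw [h0, hn]
  refine fderiv_fderiv_eq_of_line hk ?_ (hasDerivAt_kelvin_line_deriv hN hl hn1 h0 hn0 hP hv)
  have e1 : ∀ᶠ t in 𝓝 (0 : ℝ), 0 < ‖X + t • bv i‖ ^ 2 :=
    hN.continuousAt.eventually (lt_mem_nhds (by simpa only [hn1] using hn0))
  have hc : ContinuousAt (fun t : ℝ => (‖X + t • bv i‖ ^ 2)⁻¹ • (X + t • bv i)) 0 :=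
    (hN.continuousAt.inv₀ (by rw [hn1]; exact hn0.ne')).smul hl.continuousAt
  have e2 : ∀ᶠ t in 𝓝 (0 : ℝ),
      ContDiffAt ℝ 2 v ((‖X + t • bv i‖ ^ 2)⁻¹ • (X + t • bv i)) := by
    refine hc.eventually (p := fun Z => ContDiffAt ℝ 2 v Z) (ContDiffAt.eventually ?_ (by simp))
    show ContDiffAt ℝ 2 v ((‖X + (0 : ℝ) • bv i‖ ^ 2)⁻¹ • (X + (0 : ℝ) • bv i))
    rw [hn1, h0]
    exact hv
  filter_upwards [e1, e2] with t ht1 ht2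
  exact hasDerivAt_kelvin_line α X i rfl ht1 rfl hm rfl (ht2.differentiableAt (by simp))

/-- The Kelvin transform preserves solutions of the weighted equation. -/
theorem wlap_kelvin {N : ℕ} (α : ℝ) {v : Euc (N + 1) → ℝ} {X : Euc (N + 1)} (hX : 0 < yc X)
    (hv : ContDiffAt ℝ 2 v ((‖X‖ ^ 2)⁻¹ • X)) (h0 : wlap α v ((‖X‖ ^ 2)⁻¹ • X) = 0) :
    wlap α (kelvin N α v) X = 0 := by
  obtain ⟨n, hn⟩ : ∃ n, n = ‖X‖ ^ 2 := ⟨_, rfl⟩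
  obtain ⟨m, hm⟩ : ∃ m, m = (N : ℝ) - 2 * α := ⟨_, rfl⟩
  obtain ⟨P, hP⟩ : ∃ P, P = n ^ (-m / 2) := ⟨_, rfl⟩
  have hX0 := ne_zero_of_yc_pos hX
  have hn0 : 0 < n := by rw [hn]; positivity
  have hk := (contDiffAt_kelvin α hX0 hv).differentiableAt (by simp)
  rw [← hn] at hv h0
  have hsq : ∑ i, X i ^ 2 = n := by
    rw [hn, EuclideanSpace.norm_sq_eq]
    simp
  unfold wlap at h0 ⊢
  rw [Finset.sum_congr rfl fun i _ => fderiv_fderiv_kelvin α X i hn hn0 hm hP hv,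
    fderiv_kelvin α X (Fin.last N) hn hn0 hm hP hk (hv.differentiableAt (by simp))]
  have hyn : yc (n⁻¹ • X) = yc X / n := by simp [yc, div_eq_inv_mul]
  have hy : X (Fin.last N) = yc X := rfl
  rw [hyn] at h0
  rw [hy]
  generalize fderiv ℝ (fderiv ℝ v) (n⁻¹ • X) = H at h0 ⊢
  generalize fderiv ℝ v (n⁻¹ • X) = D at h0 ⊢
  generalize v (n⁻¹ • X) = V
  have hD : ∑ i, X i * D (bv i) = D X := by simpa using (map_eq_sum_bv D X).symm
  have hp : ∑ i, X i * H (bv i) X = H X X := by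
    simpa using (congrArg (fun T => T X) (map_eq_sum_bv H X)).symm
  have hq : ∑ i, X i * H X (bv i) = H X X := by simpa using (map_eq_sum_bv (H X) X).symm
  have hT : ∀ i, (-m * (P / n) + m * (m + 2) * X i ^ 2 * (P / n ^ 2)) * V +
      2 * (-m * X i * (P / n)) * D (n⁻¹ • bv i - (2 * X i / n ^ 2) • X) +
      P * (H (n⁻¹ • bv i - (2 * X i / n ^ 2) • X) (n⁻¹ • bv i - (2 * X i / n ^ 2) • X) +
        D ((-4 * X i / n ^ 2) • bv i + (8 * X i ^ 2 / n ^ 3 - 2 / n ^ 2) • X)) =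
      (-m * (P / n) * V - 2 * P / n ^ 2 * D X) +
      (m * (m + 2) * (P / n ^ 2) * V + 4 * m * P / n ^ 3 * D X + 4 * P / n ^ 4 * H X X +
        8 * P / n ^ 3 * D X) * X i ^ 2 +
      (-2 * m * P / n ^ 2 - 4 * P / n ^ 2) * (X i * D (bv i)) +
      P / n ^ 2 * H (bv i) (bv i) + (-2 * P / n ^ 3) * (X i * H (bv i) X) +
      (-2 * P / n ^ 3) * (X i * H X (bv i)) := by
    intro i
    simp only [map_sub, map_add, map_smul, smul_eq_mul, _root_.sub_apply,
      _root_.smul_apply]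
    field_simp
    ring
  rw [Finset.sum_congr rfl fun i _ => hT i]
  simp only [Finset.sum_add_distrib, ← Finset.mul_sum, hD, hp, hq, hsq, Finset.sum_const,
    Finset.card_univ, Fintype.card_fin, nsmul_eq_mul, map_sub, map_smul, smul_eq_mul]
  have hS : ∑ i, H (bv i) (bv i) = -((1 - 2 * α) / (yc X / n) * D (bv (Fin.last N))) := by
    linarith
  rw [hS, hm]
  push_cast
  field_simp
  ring

/-- First and second order conditions at a maximum of `v(P + te) - v(Q + te') - b(t)`. -/
theorem diff_line_max {E : Type*} [NormedAddCommGroup E] [NormedSpace ℝ E] {v : E → ℝ}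
    {P Q e e' : E} {b b' : ℝ → ℝ} {β : ℝ} (hP : ContDiffAt ℝ 2 v P) (hQ : ContDiffAt ℝ 2 v Q)
    (hb : ∀ᶠ t in 𝓝 (0 : ℝ), HasDerivAt b (b' t) t) (hb' : HasDerivAt b' β 0)
    (hmax : ∀ᶠ t in 𝓝 (0 : ℝ), v (P + t • e) - v (Q + t • e') - b t ≤ v P - v Q - b 0) :
    fderiv ℝ (fderiv ℝ v) P e e - fderiv ℝ (fderiv ℝ v) Q e' e' ≤ β ∧
      fderiv ℝ v P e - fderiv ℝ v Q e' = b' 0 := by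
  have h1 : ∀ᶠ t in 𝓝 (0 : ℝ), HasDerivAt (fun t => v (P + t • e) - v (Q + t • e') - b t)
      (fderiv ℝ v (P + t • e) e - fderiv ℝ v (Q + t • e') e' - b' t) t := by
    filter_upwards [eventually_hasDerivAt_comp_line hP e, eventually_hasDerivAt_comp_line hQ e',
      hb] with t h h' h'' using (h.sub h').sub h''
  have h2 := ((hasDerivAt_fderiv_line hP e).sub (hasDerivAt_fderiv_line hQ e')).sub hb'
  have hm : IsLocalMax (fun t => v (P + t • e) - v (Q + t • e') - b t) 0 := by
    filter_upwards [hmax] with t ht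
    simpa using ht
  refine ⟨sub_nonpos.1 (second_deriv_nonpos_of_isLocalMax h1 h2 hm), ?_⟩
  have h3 := hm.hasDerivAt_eq_zero h1.self_of_nhds
  simp only [zero_smul, add_zero] at h3
  linarith

/-- Reflection across the hyperplane `X_j = c`. -/
def hrefl {n : ℕ} (j : Fin n) (c : ℝ) (X : Euc n) : Euc n := X + (2 * (c - X j)) • bv j

theorem hrefl_apply_self {n : ℕ} (j : Fin n) (c : ℝ) (X : Euc n) :
    hrefl j c X j = 2 * c - X j := by
  simp [hrefl]
  ring

theorem hrefl_apply_ne {n : ℕ} {i j : Fin n} (h : i ≠ j) (c : ℝ) (X : Euc n) :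
    hrefl j c X i = X i := by
  simp [hrefl, h]

theorem hrefl_line_ne {n : ℕ} {i j : Fin n} (h : i ≠ j) (c t : ℝ) (X : Euc n) :
    hrefl j c (X + t • bv i) = hrefl j c X + t • bv i := by
  simp only [hrefl, PiLp.add_apply, PiLp.smul_apply, PiLp.single_apply, h.symm, if_false,
    smul_zero, add_zero]
  module

theorem hrefl_line_self {n : ℕ} (j : Fin n) (c t : ℝ) (X : Euc n) :
    hrefl j c (X + t • bv j) = hrefl j c X + t • -bv j := by
  simp only [hrefl, PiLp.add_apply, PiLp.smul_apply, PiLp.single_apply, if_true,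
    smul_eq_mul, mul_one]
  module

theorem continuous_hrefl {n : ℕ} (j : Fin n) (c : ℝ) : Continuous (hrefl j c) := by
  unfold hrefl
  fun_prop

theorem yc_hrefl {N : ℕ} (j : Fin N) (c : ℝ) (X : Euc (N + 1)) :
    yc (hrefl j.castSucc c X) = yc X :=
  hrefl_apply_ne (Fin.castSucc_lt_last j).ne' c X

theorem yc_add_castSucc {N : ℕ} (i : Fin N) (X : Euc (N + 1)) (t : ℝ) :
    yc (X + t • bv i.castSucc) = yc X := by
  simp [yc, (Fin.castSucc_lt_last i).ne']

theorem yc_add_last {N : ℕ} (X : Euc (N + 1)) (t : ℝ) :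
    yc (X + t • bv (Fin.last N)) = yc X + t := by
  simp [yc]

theorem castSucc_add_last {N : ℕ} (i : Fin N) (X : Euc (N + 1)) (t : ℝ) :
    (X + t • bv (Fin.last N) : Euc (N + 1)) i.castSucc = X i.castSucc := by
  simp [(Fin.castSucc_lt_last i).ne]

theorem castSucc_add_castSucc {N : ℕ} (i k : Fin N) (X : Euc (N + 1)) (t : ℝ) :
    (X + t • bv i.castSucc : Euc (N + 1)) k.castSucc = X k.castSucc + if k = i then t else 0 := by
  simp

/-- The tangential squared distance to `X₀`. -/
def tdist {N : ℕ} (X₀ X : Euc (N + 1)) : ℝ :=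
  ∑ i : Fin N, (X i.castSucc - X₀ i.castSucc) ^ 2

theorem tdist_nonneg {N : ℕ} (X₀ X : Euc (N + 1)) : 0 ≤ tdist X₀ X :=
  Finset.sum_nonneg fun _ _ => sq_nonneg _

theorem sq_le_tdist {N : ℕ} (X₀ X : Euc (N + 1)) (i : Fin N) :
    (X i.castSucc - X₀ i.castSucc) ^ 2 ≤ tdist X₀ X :=
  Finset.single_le_sum (f := fun i : Fin N => (X i.castSucc - X₀ i.castSucc) ^ 2)
    (fun _ _ => sq_nonneg _) (Finset.mem_univ i)

theorem tdist_add_castSucc {N : ℕ} (X₀ X : Euc (N + 1)) (i : Fin N) (t : ℝ) :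
    tdist X₀ (X + t • bv i.castSucc) =
      tdist X₀ X + (2 * (X i.castSucc - X₀ i.castSucc) * t + t ^ 2) := by
  unfold tdist
  have h : ∀ k : Fin N, ((X + t • bv i.castSucc : Euc (N + 1)) k.castSucc - X₀ k.castSucc) ^ 2 =
      (X k.castSucc - X₀ k.castSucc) ^ 2 +
        if k = i then 2 * (X i.castSucc - X₀ i.castSucc) * t + t ^ 2 else 0 := by
    intro k
    rw [castSucc_add_castSucc]
    split_ifs with hk
    · subst hk; ring
    · ring
  rw [Finset.sum_congr rfl fun k _ => h k, Finset.sum_add_distrib]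
  simp

theorem tdist_add_last {N : ℕ} (X₀ X : Euc (N + 1)) (t : ℝ) :
    tdist X₀ (X + t • bv (Fin.last N)) = tdist X₀ X := by
  simp only [tdist, castSucc_add_last]

theorem continuous_tdist {N : ℕ} (X₀ : Euc (N + 1)) : Continuous (tdist X₀) := by
  unfold tdist
  fun_prop

theorem continuous_yc {N : ℕ} : Continuous (yc : Euc (N + 1) → ℝ) := by
  unfold yc
  fun_prop

theorem wlap_eq {N : ℕ} (α : ℝ) (v : Euc (N + 1) → ℝ) (X : Euc (N + 1)) :
    wlap α v X = ∑ i : Fin N, fderiv ℝ (fderiv ℝ v) X (bv i.castSucc) (bv i.castSucc) +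
      fderiv ℝ (fderiv ℝ v) X (bv (Fin.last N)) (bv (Fin.last N)) +
      (1 - 2 * α) / yc X * fderiv ℝ v X (bv (Fin.last N)) := by
  rw [wlap, Fin.sum_univ_castSucc]

/-- The weighted half-space problem with boundary flux `F(v)`. -/
structure HalfSol (N : ℕ) (α : ℝ) (F : ℝ → ℝ) (v : Euc (N + 1) → ℝ) : Prop where
  cont : ContinuousOn v {X | 0 ≤ yc X}
  smooth : ∀ X, 0 < yc X → ContDiffAt ℝ 2 v X
  pde : ∀ X, 0 < yc X → wlap α v X = 0
  neumann : ∀ X, yc X = 0 → Tendsto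
    (fun t : ℝ => t ^ (1 - 2 * α) * fderiv ℝ v (X + t • bv (Fin.last N)) (bv (Fin.last N)))
    (𝓝[>] 0) (𝓝 (F (v X)))

theorem HalfSol.neg {N : ℕ} {α : ℝ} {F : ℝ → ℝ} {v : Euc (N + 1) → ℝ} (h : HalfSol N α F v) :
    HalfSol N α (fun a => -F (-a)) (fun X => -v X) where
  cont := h.cont.neg
  smooth X hX := (h.smooth X hX).neg
  pde X hX := by
    have h1 := h.pde X hX
    have e1 : fderiv ℝ (fun X => -v X) = fun X => -fderiv ℝ v X := funext fun X => fderiv_fun_neg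
    have e2 : fderiv ℝ (fderiv ℝ (fun X => -v X)) X = -fderiv ℝ (fderiv ℝ v) X := by
      rw [e1]; exact fderiv_fun_neg
    rw [wlap] at h1 ⊢
    rw [e2, e1]
    simp only [neg_apply, Finset.sum_neg_distrib]
    linarith
  neumann X hX := by
    have h1 := (h.neumann X hX).neg
    rw [neg_neg]
    refine h1.congr fun t => ?_
    rw [fderiv_fun_neg, neg_apply]
    ring

/-- A closed cylinder around the vertical line through `X₀`. -/
def tbox {N : ℕ} (X₀ : Euc (N + 1)) (r l u : ℝ) : Set (Euc (N + 1)) :=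
  {X | (∀ i : Fin N, |X i.castSucc - X₀ i.castSucc| ≤ r) ∧ yc X ∈ Icc l u}

theorem isCompact_tbox {N : ℕ} (X₀ : Euc (N + 1)) (r l u : ℝ) : IsCompact (tbox X₀ r l u) := by
  convert isCompact_box (Fin.snoc (fun i : Fin N => X₀ i.castSucc - r) l : Fin (N + 1) → ℝ)
    (Fin.snoc (fun i : Fin N => X₀ i.castSucc + r) u : Fin (N + 1) → ℝ) using 1
  ext X
  simp only [tbox, mem_ofPred_eq, Fin.forall_fin_succ', Fin.snoc_castSucc, Fin.snoc_last, abs_le,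
    mem_Icc, yc]
  refine and_congr_left fun _ => forall_congr' fun i => ?_
  constructor <;> rintro ⟨h1, h2⟩ <;> constructor <;> linarith

theorem tbox_mem_nhds {N : ℕ} {X₀ X : Euc (N + 1)} {r l u : ℝ}
    (h : ∀ i : Fin N, |X i.castSucc - X₀ i.castSucc| < r) (hl : l < yc X) (hu : yc X < u) :
    tbox X₀ r l u ∈ 𝓝 X := by
  have h1 : ∀ᶠ Z in 𝓝 X, ∀ i : Fin N, |Z i.castSucc - X₀ i.castSucc| < r :=
    eventually_all.2 fun i => ContinuousAt.eventually_lt (f := fun Z : Euc (N + 1) =>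
      |Z i.castSucc - X₀ i.castSucc|) (by fun_prop) continuousAt_const (h i)
  filter_upwards [h1, continuous_yc.continuousAt.eventually_const_lt hl,
    continuous_yc.continuousAt.eventually_lt_const hu] with Z h1 h2 h3
  exact ⟨fun i => (h1 i).le, h2.le, h3.le⟩

/-- `diff_line_max` with a quadratic comparison function. -/
theorem diff_line_max_quad {E : Type*} [NormedAddCommGroup E] [NormedSpace ℝ E] {v : E → ℝ}
    {P Q e e' : E} {b c : ℝ} (hP : ContDiffAt ℝ 2 v P) (hQ : ContDiffAt ℝ 2 v Q)
    (hmax : ∀ᶠ t in 𝓝 (0 : ℝ),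
      v (P + t • e) - v (Q + t • e') - (b * t + c * t ^ 2) ≤ v P - v Q) :
    fderiv ℝ (fderiv ℝ v) P e e - fderiv ℝ (fderiv ℝ v) Q e' e' ≤ 2 * c ∧
      fderiv ℝ v P e - fderiv ℝ v Q e' = b := by
  have h := diff_line_max (e := e) (e' := e') (b := fun t => b * t + c * t ^ 2)
    (b' := fun t => b + 2 * c * t) (β := 2 * c) hP hQ
    (.of_forall fun t => by
      refine (((hasDerivAt_id' t).const_mul b).add
        ((hasDerivAt_pow 2 t).const_mul c)).congr_deriv ?_
      push_cast
      ring)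
    (by simpa using ((hasDerivAt_id (0 : ℝ)).const_mul (2 * c)).const_add b)
    (by simpa using hmax)
  simpa using h

theorem doubling_arith {α ρ y t K A N S T p q : ℝ} (hα : α ∈ Ioo (0 : ℝ) 1) (hρ : 0 < ρ)
    (hK : 0 < K) (hA : A = K * (N + 2)) (hN : 0 ≤ N) (ht0 : 0 < t) (htρ : t < ρ)
    (hy3 : 3 * ρ < y) (hy5 : y < 5 * ρ) (hST : S - T ≤ N * (2 * K)) (hp : p ≤ 2 * (K - A))
    (hq : -q ≤ 2 * -A)
    (pP : S + p + (1 - 2 * α) / y * (2 * K * (y - 4 * ρ) + 2 * A * (ρ - t)) = 0)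
    (pQ : T + q + (1 - 2 * α) / (y - t) * (2 * A * (ρ - t)) = 0) : False := by
  have hA0 : 0 < A := by rw [hA]; positivity
  have hy0 : 0 < y := by linarith
  have hy20 : 0 < y - t := by linarith
  have ha : |1 - 2 * α| ≤ 1 := abs_le.2 ⟨by linarith [hα.2], by linarith [hα.1]⟩
  have e1 : (1 - 2 * α) / y * (2 * K * (y - 4 * ρ)) ≤ 2 * K / 3 := by
    have : |(1 - 2 * α) / y * (2 * K * (y - 4 * ρ))| ≤ 1 / (3 * ρ) * (2 * K * ρ) := by
      rw [abs_mul, abs_div, abs_mul, abs_of_pos hy0, abs_of_pos (by positivity : 0 < 2 * K)]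
      have : |y - 4 * ρ| ≤ ρ := abs_le.2 ⟨by linarith, by linarith⟩
      gcongr
    calc _ ≤ _ := le_abs_self _
      _ ≤ _ := this
      _ = 2 * K / 3 := by field_simp
  have e2 : (1 - 2 * α) / y * (2 * A * (ρ - t)) - (1 - 2 * α) / (y - t) * (2 * A * (ρ - t)) ≤
      A / 3 := by
    have : (1 - 2 * α) / y * (2 * A * (ρ - t)) - (1 - 2 * α) / (y - t) * (2 * A * (ρ - t)) =
      -((1 - 2 * α) * (t / (y * (y - t))) * (2 * A * (ρ - t))) := by field_simp; ring
    rw [this]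
    have : |(1 - 2 * α) * (t / (y * (y - t))) * (2 * A * (ρ - t))| ≤
        1 * (ρ / (3 * ρ * (2 * ρ))) * (2 * A * ρ) := by
      rw [abs_mul, abs_mul, abs_of_nonneg (by positivity : 0 ≤ t / (y * (y - t))),
        abs_of_nonneg (mul_nonneg (by positivity) (by linarith) : 0 ≤ 2 * A * (ρ - t))]
      gcongr <;> linarith
    calc _ ≤ _ := neg_le_abs _
      _ ≤ _ := this
      _ = A / 3 := by field_simp
  rw [mul_add] at pP
  have hfin : 4 * A ≤ 2 * K * N + 2 * K + 2 * K / 3 + A / 3 := by linarith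
  rw [hA] at hfin
  nlinarith [mul_nonneg hK.le hN]

/-- Interior estimate for the vertical derivative, by doubling the vertical variable. -/
theorem fderiv_last_le {N : ℕ} {α : ℝ} (hα : α ∈ Ioo (0 : ℝ) 1) {z : Euc (N + 1) → ℝ}
    {X₀ : Euc (N + 1)} {ε ρ : ℝ} (hε : 0 < ε) (hρ : 0 < ρ) (hy : yc X₀ = 4 * ρ)
    (hs : ∀ X ∈ tbox X₀ ρ (2 * ρ) (5 * ρ), ContDiffAt ℝ 2 z X)
    (hz : ∀ X ∈ tbox X₀ ρ (2 * ρ) (5 * ρ), wlap α z X = 0)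
    (hb : ∀ X ∈ tbox X₀ ρ (2 * ρ) (5 * ρ), |z X| ≤ ε) :
    fderiv ℝ z X₀ (bv (Fin.last N)) ≤ 4 * (N + 2) * ε / ρ := by
  set e : Euc (N + 1) := bv (Fin.last N) with he
  set K : ℝ := 2 * ε / ρ ^ 2 with hK
  have hKρ : K * ρ ^ 2 = 2 * ε := by rw [hK]; field_simp
  have hK0 : 0 < K := by positivity
  set A : ℝ := K * (N + 2) with hA
  have hN0 : (0 : ℝ) ≤ N := N.cast_nonneg
  have hA0 : 0 < A := by positivity
  have hAρ : 2 * ε ≤ A * ρ ^ 2 := by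
    rw [hA, mul_right_comm, hKρ]; nlinarith
  set D : Set (Euc (N + 1) × ℝ) := tbox X₀ ρ (3 * ρ) (5 * ρ) ×ˢ Icc 0 ρ with hD
  set Φ : Euc (N + 1) × ℝ → ℝ := fun p => z p.1 - z (p.1 + (-p.2) • e) -
    (K * tdist X₀ p.1 + K * (yc p.1 - 4 * ρ) ^ 2 + A * (2 * ρ * p.2 - p.2 ^ 2)) with hΦ
  have hD1 : ∀ p ∈ D, p.1 ∈ tbox X₀ ρ (2 * ρ) (5 * ρ) := fun p hp =>
    ⟨hp.1.1, by linarith [hp.1.2.1], hp.1.2.2⟩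
  have hD2 : ∀ p ∈ D, p.1 + (-p.2) • e ∈ tbox X₀ ρ (2 * ρ) (5 * ρ) := fun p hp => by
    refine ⟨fun i => ?_, ?_⟩
    · rw [castSucc_add_last]; exact hp.1.1 i
    · rw [yc_add_last]
      exact ⟨by linarith [hp.1.2.1, hp.2.2], by linarith [hp.1.2.2, hp.2.1]⟩
  have hcont : ContinuousOn Φ D := by
    have hzc : ContinuousOn z (tbox X₀ ρ (2 * ρ) (5 * ρ)) := fun X hX =>
      (hs X hX).continuousAt.continuousWithinAt
    have h1 : ContinuousOn (fun p : Euc (N + 1) × ℝ => z p.1) D :=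
      hzc.comp continuous_fst.continuousOn hD1
    have h2 : ContinuousOn (fun p : Euc (N + 1) × ℝ => z (p.1 + (-p.2) • e)) D :=
      hzc.comp (f := fun p : Euc (N + 1) × ℝ => p.1 + (-p.2) • e)
        (by fun_prop) hD2
    have h3 := (continuous_tdist X₀).comp (continuous_fst (Y := ℝ))
    have h4 := (continuous_yc (N := N)).comp (continuous_fst (Y := ℝ))
    simp only [Function.comp_def] at h3 h4
    exact (h1.sub h2).sub (Continuous.continuousOn (by fun_prop))
  have hX₀ : X₀ ∈ tbox X₀ ρ (3 * ρ) (5 * ρ) :=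
    ⟨fun i => by simpa using hρ.le, by rw [hy]; constructor <;> linarith⟩
  obtain ⟨⟨X, t⟩, hp, hmax⟩ := ((isCompact_tbox X₀ ρ (3 * ρ) (5 * ρ)).prod
    (isCompact_Icc (a := 0) (b := ρ))).exists_isMaxOn ⟨(X₀, 0), hX₀, by simp [hρ.le]⟩ hcont
  have key : Φ (X, t) ≤ 0 := by
    by_contra! hpos
    have hzz : z X - z (X + (-t) • e) ≤ 2 * ε := by
      have h1 := (abs_le.1 (hb _ (hD1 _ hp))).2
      have h2 := (abs_le.1 (hb _ (hD2 _ hp))).1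
      simp only at h1 h2
      linarith
    obtain ⟨⟨hp1, hp2, hp3⟩, hp4, hp5⟩ := hp
    simp only at hp1 hp2 hp3 hp4 hp5
    simp only [hΦ] at hpos
    have htd := mul_nonneg hK0.le (tdist_nonneg X₀ X)
    have hyd := mul_nonneg hK0.le (sq_nonneg (yc X - 4 * ρ))
    have htt : 0 ≤ A * (2 * ρ * t - t ^ 2) := mul_nonneg hA0.le (by nlinarith)
    have ht0 : 0 < t := by
      refine lt_of_le_of_ne hp4 fun h => ?_
      subst h
      simp at hpos
      linarith
    have htρ : t < ρ := by
      refine lt_of_le_of_ne hp5 fun h => ?_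
      subst h
      nlinarith
    have hXi : ∀ i : Fin N, |X i.castSucc - X₀ i.castSucc| < ρ := by
      refine fun i => lt_of_le_of_ne (hp1 i) fun h => ?_
      have h1 := mul_le_mul_of_nonneg_left (sq_le_tdist X₀ X i) hK0.le
      rw [← sq_abs, h, hKρ] at h1
      linarith
    have hy3 : 3 * ρ < yc X := by
      refine lt_of_le_of_ne hp2 fun h => ?_
      rw [← h] at hpos hyd
      nlinarith
    have hy5 : yc X < 5 * ρ := by
      refine lt_of_le_of_ne hp3 fun h => ?_
      rw [h] at hpos hyd
      nlinarith
    have hnhds : D ∈ 𝓝 (X, t) := prod_mem_nhds (tbox_mem_nhds hXi hy3 hy5) (Icc_mem_nhds ht0 htρ)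
    have hloc : ∀ c : ℝ → Euc (N + 1) × ℝ, Continuous c → c 0 = (X, t) →
        ∀ᶠ s in 𝓝 (0 : ℝ), Φ (c s) ≤ Φ (X, t) := fun c hc h0 => by
      have h1 : ∀ᶠ s in 𝓝 (0 : ℝ), c s ∈ D := hc.continuousAt.eventually (by rw [h0]; exact hnhds)
      filter_upwards [h1] with s hs using hmax hs
    have hDX : (X, t) ∈ D := mem_of_mem_nhds hnhds
    have hP := hs _ (hD1 _ hDX)
    have hQ := hs _ (hD2 _ hDX)
    have pP := hz _ (hD1 _ hDX)
    have pQ := hz _ (hD2 _ hDX)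
    simp only at hP hQ pP pQ
    set Q := X + (-t) • e with hQe
    have tang : ∀ i : Fin N, fderiv ℝ (fderiv ℝ z) X (bv i.castSucc) (bv i.castSucc) -
        fderiv ℝ (fderiv ℝ z) Q (bv i.castSucc) (bv i.castSucc) ≤ 2 * K := fun i => by
      refine (diff_line_max_quad (b := K * (2 * (X i.castSucc - X₀ i.castSucc))) hP hQ ?_).1
      filter_upwards [hloc (fun s => (X + s • bv i.castSucc, t)) (by fun_prop) (by simp)]
        with s hs
      simp only [hΦ, tdist_add_castSucc, yc_add_castSucc] at hs
      have h5 : X + s • bv i.castSucc + -t • e = Q + s • bv i.castSucc := by rw [hQe]; abel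
      rw [h5, ← hQe] at hs
      linarith
    have up := diff_line_max_quad (e := e) (e' := 0)
      (b := 2 * K * (yc X - 4 * ρ) + 2 * A * (ρ - t)) (c := K - A) hP hQ (by
        filter_upwards [hloc (fun s => (X + s • e, t + s)) (by fun_prop) (by simp)] with s hs
        simp only [hΦ, tdist_add_last, yc_add_last, he] at hs
        have h5 : X + s • e + -(t + s) • e = Q + s • (0 : Euc (N + 1)) := by rw [hQe]; module
        rw [← he, h5, ← hQe] at hs
        linarith)
    have dn := diff_line_max_quad (e := 0) (e' := e) (b := -(2 * A * (ρ - t))) (c := -A) hP hQ (by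
        filter_upwards [hloc (fun s => (X, t - s)) (by fun_prop) (by simp)] with s hs
        simp only [hΦ] at hs
        have h5 : X + -(t - s) • e = Q + s • e := by rw [hQe]; module
        rw [h5, ← hQe] at hs
        simp only [smul_zero, add_zero]
        linarith)
    simp only [map_zero, sub_zero, zero_sub] at up dn
    have htang := Finset.sum_le_sum fun i (_ : i ∈ (Finset.univ : Finset (Fin N))) => tang i
    rw [Finset.sum_sub_distrib] at htang
    simp only [Finset.sum_const, Finset.card_univ, Fintype.card_fin, nsmul_eq_mul] at htang
    rw [wlap_eq, ← he] at pP pQ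
    have hyQ : yc Q = yc X - t := by rw [hQe, he, yc_add_last]; ring
    rw [hyQ, neg_injective dn.2] at pQ
    rw [up.2] at pP
    exact doubling_arith hα hρ hK0 hA hN0 ht0 htρ hy3 hy5 htang up.1 dn.1 pP pQ
  have hline : ∀ t ∈ Ioo 0 ρ, z X₀ - z (X₀ + t • (-e)) ≤ 2 * A * ρ * t := fun t ht => by
    have hm : (X₀, t) ∈ D := ⟨hX₀, ht.1.le, ht.2.le⟩
    have h1 := hmax hm
    simp only [mem_ofPred_eq] at h1
    have h2 := h1.trans key
    simp only [hΦ, hy, sub_self] at h2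
    rw [show X₀ + t • -e = X₀ + -t • e by module]
    have h3 : tdist X₀ X₀ = 0 := by simp [tdist]
    rw [h3] at h2
    have := mul_nonneg hA0.le (sq_nonneg t)
    linarith
  have hd : HasDerivAt (fun t : ℝ => z X₀ - z (X₀ + t • (-e))) (fderiv ℝ z X₀ e) 0 := by
    have h1 : DifferentiableAt ℝ z (X₀ + (0 : ℝ) • (-e)) := by
      simpa using (hs X₀ ⟨hX₀.1, by linarith [hX₀.2.1], hX₀.2.2⟩).differentiableAt (by simp)
    simpa using (hasDerivAt_comp_line h1).const_sub (z X₀)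
  have := hasDerivAt_le_of_le_mul hρ hd (by simp) hline
  calc _ ≤ _ := this
    _ = _ := by rw [hA, hK]; field_simp; ring

/-- The vertical profile of the barrier in the reflection argument. -/
def barrier (α κ c K η t : ℝ) : ℝ := (1 - κ * t ^ (2 * α)) * (c + K * (t ^ 2 - η ^ 2) ^ 2)

/-- The derivative of `barrier`. -/
def barrier' (α κ c K η t : ℝ) : ℝ :=
  -(2 * α * κ * t ^ (2 * α - 1)) * (c + K * (t ^ 2 - η ^ 2) ^ 2) +
    (1 - κ * t ^ (2 * α)) * (4 * K * t * (t ^ 2 - η ^ 2))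

theorem hasDerivAt_barrier (α κ c K η : ℝ) {t : ℝ} (ht : 0 < t) :
    HasDerivAt (barrier α κ c K η) (barrier' α κ c K η t) t := by
  have h1 := ((Real.hasDerivAt_rpow_const (p := 2 * α) (Or.inl ht.ne')).const_mul κ).const_sub 1
  have h2 := ((((hasDerivAt_pow 2 t).sub_const (η ^ 2)).pow 2).const_mul K).const_add c
  refine (h1.mul h2).congr_deriv ?_
  simp only [barrier', Pi.pow_apply]
  push_cast
  ring

theorem hasDerivAt_barrier' (α κ c K η : ℝ) {t : ℝ} (ht : 0 < t) :
    HasDerivAt (barrier' α κ c K η)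
      (-((1 - 2 * α) / t) * barrier' α κ c K η t - 16 * α * κ * K * t ^ (2 * α) * (t ^ 2 - η ^ 2) +
        4 * K * (1 - κ * t ^ (2 * α)) * ((2 - 2 * α) * (t ^ 2 - η ^ 2) + 2 * t ^ 2)) t := by
  have h1 := ((Real.hasDerivAt_rpow_const (p := 2 * α) (Or.inl ht.ne')).const_mul κ).const_sub 1
  have h2 := ((((hasDerivAt_pow 2 t).sub_const (η ^ 2)).pow 2).const_mul K).const_add c
  have h3 := ((Real.hasDerivAt_rpow_const (p := 2 * α - 1) (Or.inl ht.ne')).const_mul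
    (2 * α * κ)).neg
  have h4 := ((hasDerivAt_id' t).const_mul (4 * K)).mul ((hasDerivAt_pow 2 t).sub_const (η ^ 2))
  refine ((h3.mul h2).add (h1.mul h4)).congr_deriv ?_
  simp only [barrier', Pi.neg_apply, Pi.mul_apply, Pi.pow_apply]
  rw [Real.rpow_sub_one ht.ne', Real.rpow_sub_one ht.ne']
  field_simp
  ring

theorem tendsto_rpow_nhdsGT_zero {p : ℝ} (hp : 0 < p) :
    Tendsto (fun t : ℝ => t ^ p) (𝓝[>] 0) (𝓝 0) := by
  have h := (Real.continuousAt_rpow_const 0 p (Or.inr hp.le)).tendsto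
  rw [Real.zero_rpow hp.ne'] at h
  exact h.mono_left nhdsWithin_le_nhds

theorem tendsto_barrier' {α : ℝ} (hα : α ∈ Ioo (0 : ℝ) 1) (κ c K η : ℝ) :
    Tendsto (fun t => t ^ (1 - 2 * α) * barrier' α κ c K η t) (𝓝[>] 0)
      (𝓝 (-(2 * α * κ) * (c + K * η ^ 4))) := by
  have hid : Tendsto (fun t : ℝ => t) (𝓝[>] 0) (𝓝 0) := nhdsWithin_le_nhds
  have h1 := tendsto_rpow_nhdsGT_zero (p := 2 * α) (by linarith [hα.1])
  have h2 := tendsto_rpow_nhdsGT_zero (p := 2 - 2 * α) (by linarith [hα.2])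
  have hw := (hid.pow 2).sub_const (η ^ 2)
  have h3 := (((hw.pow 2).const_mul K).const_add c).const_mul (-(2 * α * κ))
  have h4 := ((h1.const_mul κ).const_sub 1).mul ((h2.const_mul (4 * K)).mul hw)
  have h5 := h3.add h4
  rw [show -(2 * α * κ) * (c + K * ((0 : ℝ) ^ 2 - η ^ 2) ^ 2) +
    (1 - κ * 0) * (4 * K * 0 * ((0 : ℝ) ^ 2 - η ^ 2)) =
      -(2 * α * κ) * (c + K * η ^ 4) by ring] at h5
  refine h5.congr' ?_
  filter_upwards [self_mem_nhdsWithin] with t ht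
  have ht : 0 < t := ht
  have e1 : t ^ (1 - 2 * α) * t ^ (2 * α - 1) = 1 := by
    rw [← Real.rpow_add ht]; simp
  have e2 : t ^ (1 - 2 * α) * t = t ^ (2 - 2 * α) := by
    rw [← Real.rpow_add_one ht.ne']; ring_nf
  rw [barrier', ← e2]
  linear_combination (2 * α * κ * (c + K * (t ^ 2 - η ^ 2) ^ 2)) * e1

theorem continuous_barrier {α : ℝ} (hα : 0 < α) (κ c K η : ℝ) :
    Continuous (barrier α κ c K η) := by
  have h := Real.continuous_rpow_const (q := 2 * α) (by linarith)
  unfold barrier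
  fun_prop

/-- The weighted vertical operator applied to `barrier` is at most `24K`. -/
theorem barrier_operator_le {α κ K η t r : ℝ} (hα : α ∈ Ioo (0 : ℝ) 1) (hκ : 0 ≤ κ) (hK : 0 ≤ K)
    (ht : 0 ≤ t) (htr : t ≤ r) (hr : r ≤ 1) (hη : 0 ≤ η) (hηr : η ≤ r)
    (hκr : κ * r ^ (2 * α) ≤ 1 / 2) :
    -(16 * α * κ * K * t ^ (2 * α) * (t ^ 2 - η ^ 2)) +
      4 * K * (1 - κ * t ^ (2 * α)) * ((2 - 2 * α) * (t ^ 2 - η ^ 2) + 2 * t ^ 2) ≤ 24 * K := by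
  have h1 : κ * t ^ (2 * α) ≤ 1 / 2 := le_trans (by gcongr; linarith [hα.1]) hκr
  have h0 : 0 ≤ κ * t ^ (2 * α) := by positivity
  set G := κ * t ^ (2 * α)
  have ht2 : t ^ 2 ≤ 1 := by nlinarith
  have hη2 : η ^ 2 ≤ 1 := by nlinarith
  have hw : -(t ^ 2 - η ^ 2) ≤ 1 := by nlinarith
  have e1 : α * G ≤ 1 / 2 := by nlinarith [hα.1, hα.2]
  have e1' : 0 ≤ α * G := mul_nonneg hα.1.le h0
  have e2 : -(α * G * (t ^ 2 - η ^ 2)) ≤ 1 / 2 := by nlinarith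
  have e3 : (2 - 2 * α) * (t ^ 2 - η ^ 2) + 2 * t ^ 2 ≤ 4 := by nlinarith [hα.1, hα.2, sq_nonneg η]
  have e4 : (1 - G) * ((2 - 2 * α) * (t ^ 2 - η ^ 2) + 2 * t ^ 2) ≤ 4 := by nlinarith
  have := mul_le_mul_of_nonneg_left (add_le_add
    (mul_le_mul_of_nonneg_left e2 (by norm_num : (0 : ℝ) ≤ 16))
    (mul_le_mul_of_nonneg_left e4 (by norm_num : (0:ℝ) ≤ 4))) hK
  calc _ = K * (16 * -(α * G * (t ^ 2 - η ^ 2)) +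
        4 * ((1 - G) * ((2 - 2 * α) * (t ^ 2 - η ^ 2) + 2 * t ^ 2))) := by simp only [G]; ring
    _ ≤ _ := this
    _ = _ := by ring

theorem reflection_arith {α K A y N S T p q d d' B' G G' : ℝ}
    (hA : A = (N + 30) * K) (hK : 0 < K) (hG : 1 / 2 ≤ G)
    (hST : S - T ≤ N * (2 * (G * K)) - 2 * (G * A))
    (hp : p - q ≤ -((1 - 2 * α) / y) * B' + G') (hG' : G' ≤ 24 * K) (hd : d - d' = B')
    (pP : S + p + (1 - 2 * α) / y * d = 0) (pQ : T + q + (1 - 2 * α) / y * d' = 0) : False := by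
  subst hA hd
  rw [mul_sub] at hp
  nlinarith

/-- The tangential part of the comparison function in the reflection argument. -/
def rbar {N : ℕ} (j : Fin N) (X₀ : Euc (N + 1)) (A K r : ℝ) (X : Euc (N + 1)) : ℝ :=
  A * (2 * r * (X j.castSucc - X₀ j.castSucc) - (X j.castSucc - X₀ j.castSucc) ^ 2) +
    K * tdist X₀ X

theorem rbar_add_last {N : ℕ} (j : Fin N) (X₀ : Euc (N + 1)) (A K r : ℝ) (X : Euc (N + 1)) (t : ℝ) :
    rbar j X₀ A K r (X + t • bv (Fin.last N)) = rbar j X₀ A K r X := by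
  simp only [rbar, tdist_add_last, castSucc_add_last]

theorem rbar_add_castSucc_self {N : ℕ} (j : Fin N) (X₀ : Euc (N + 1)) (A K r : ℝ)
    (X : Euc (N + 1)) (t : ℝ) :
    rbar j X₀ A K r (X + t • bv j.castSucc) = rbar j X₀ A K r X +
      ((2 * A * (r - (X j.castSucc - X₀ j.castSucc)) +
        2 * K * (X j.castSucc - X₀ j.castSucc)) * t + (K - A) * t ^ 2) := by
  simp only [rbar, tdist_add_castSucc, castSucc_add_castSucc, if_true]
  ring

theorem rbar_add_castSucc_ne {N : ℕ} {i j : Fin N} (hij : i ≠ j) (X₀ : Euc (N + 1)) (A K r : ℝ)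
    (X : Euc (N + 1)) (t : ℝ) :
    rbar j X₀ A K r (X + t • bv i.castSucc) = rbar j X₀ A K r X +
      (2 * K * (X i.castSucc - X₀ i.castSucc) * t + K * t ^ 2) := by
  simp only [rbar, tdist_add_castSucc, castSucc_add_castSucc, hij.symm, if_false]
  ring

theorem continuous_rbar {N : ℕ} (j : Fin N) (X₀ : Euc (N + 1)) (A K r : ℝ) :
    Continuous (rbar j X₀ A K r) := by
  have h1 := continuous_tdist X₀
  unfold rbar
  fun_prop

theorem rbar_nonneg {N : ℕ} {j : Fin N} {X₀ X : Euc (N + 1)} {A K r : ℝ} (hA : 0 ≤ A) (hK : 0 ≤ K)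
    (h0 : X₀ j.castSucc ≤ X j.castSucc) (h1 : X j.castSucc - X₀ j.castSucc ≤ r) :
    0 ≤ rbar j X₀ A K r X :=
  add_nonneg (mul_nonneg hA (by nlinarith)) (mul_nonneg hK (tdist_nonneg _ _))

/-- No interior touching point in the reflection argument. -/
theorem reflection_interior {N : ℕ} {α : ℝ} {F : ℝ → ℝ} {v : Euc (N + 1) → ℝ}
    (hα : α ∈ Ioo (0 : ℝ) 1) (h : HalfSol N α F v) {X₀ Y : Euc (N + 1)} {r κ K A m : ℝ}
    (j : Fin N) (hr1 : r ≤ 1) (hy0 : 0 ≤ yc X₀) (hyr : yc X₀ ≤ r) (hκ : 0 ≤ κ)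
    (hκr : κ * r ^ (2 * α) ≤ 1 / 2) (hK : 0 < K) (hA : A = (N + 30) * K)
    (hle : ∀ᶠ Z in 𝓝 Y, v Z - v (hrefl j.castSucc (X₀ j.castSucc) Z) ≤
      barrier α κ (rbar j X₀ A K r Z + m) K (yc X₀) (yc Z))
    (heq : v Y - v (hrefl j.castSucc (X₀ j.castSucc) Y) =
      barrier α κ (rbar j X₀ A K r Y + m) K (yc X₀) (yc Y))
    (hY0 : 0 < yc Y) (hYr : yc Y ≤ r) : False := by
  set Q := hrefl j.castSucc (X₀ j.castSucc) Y with hQe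
  have hQy : yc Q = yc Y := yc_hrefl _ _ _
  have hP := h.smooth Y hY0
  have hQ := h.smooth Q (by rwa [hQy])
  have pP := h.pde Y hY0
  have pQ := h.pde Q (by rwa [hQy])
  rw [wlap_eq] at pP pQ
  rw [hQy] at pQ
  have hloc := fun e : Euc (N + 1) => (tendsto_line Y e).eventually hle
  set G : ℝ := 1 - κ * yc Y ^ (2 * α) with hG
  have hG2 : 1 / 2 ≤ G := by
    have : κ * yc Y ^ (2 * α) ≤ κ * r ^ (2 * α) :=
      mul_le_mul_of_nonneg_left (Real.rpow_le_rpow hY0.le hYr (by linarith [hα.1])) hκ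
    rw [hG]
    linarith
  have tang : ∀ i : Fin N, fderiv ℝ (fderiv ℝ v) Y (bv i.castSucc) (bv i.castSucc) -
      fderiv ℝ (fderiv ℝ v) Q (bv i.castSucc) (bv i.castSucc) ≤
        2 * (G * K) + if i = j then -(2 * (G * A)) else 0 := fun i => by
    by_cases hij : i = j
    · subst hij
      have h1 := (diff_line_max_quad (e := bv i.castSucc) (e' := -bv i.castSucc)
        (b := G * (2 * A * (r - (Y i.castSucc - X₀ i.castSucc)) +
          2 * K * (Y i.castSucc - X₀ i.castSucc))) (c := G * (K - A)) hP hQ (by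
        filter_upwards [hloc (bv i.castSucc)] with t ht
        rw [hrefl_line_self, rbar_add_castSucc_self, yc_add_castSucc, ← hQe] at ht
        rw [heq]
        simp only [barrier, ← hG] at ht ⊢
        linarith)).1
      simp only [map_neg, neg_apply, neg_neg] at h1
      rw [if_pos rfl]
      linarith
    · have h1 := (diff_line_max_quad (e := bv i.castSucc) (e' := bv i.castSucc)
        (b := G * (2 * K * (Y i.castSucc - X₀ i.castSucc))) (c := G * K) hP hQ (by
        filter_upwards [hloc (bv i.castSucc)] with t ht
        rw [hrefl_line_ne (by simpa using hij), rbar_add_castSucc_ne hij, yc_add_castSucc,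
          ← hQe] at ht
        rw [heq]
        simp only [barrier, ← hG] at ht ⊢
        linarith)).1
      rw [if_neg hij]
      linarith
  have htang := Finset.sum_le_sum fun i (_ : i ∈ (Finset.univ : Finset (Fin N))) => tang i
  rw [Finset.sum_sub_distrib, Finset.sum_add_distrib, Finset.sum_ite_eq'] at htang
  simp only [Finset.sum_const, Finset.card_univ, Fintype.card_fin, nsmul_eq_mul,
    Finset.mem_univ, if_true] at htang
  set c := rbar j X₀ A K r Y + m with hc
  have hB : ∀ᶠ t in 𝓝 (0 : ℝ), HasDerivAt (fun t => barrier α κ c K (yc X₀) (yc Y + t))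
      (barrier' α κ c K (yc X₀) (yc Y + t)) t := by
    have : ∀ᶠ t in 𝓝 (0 : ℝ), -yc Y < t := lt_mem_nhds (by linarith)
    filter_upwards [this] with t ht
    exact (hasDerivAt_barrier α κ c K (yc X₀) (by linarith : 0 < yc Y + t)).comp_const_add _ _
  have hB' := (hasDerivAt_barrier' α κ c K (yc X₀)
    (by linarith : 0 < yc Y + 0)).comp_const_add (yc Y) 0
  have vert := diff_line_max (e := bv (Fin.last N)) (e' := bv (Fin.last N)) hP hQ hB hB' (by
    filter_upwards [hloc (bv (Fin.last N))] with t ht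
    rw [hrefl_line_ne (Fin.castSucc_lt_last j).ne', rbar_add_last, yc_add_last, ← hQe] at ht
    rw [add_zero, heq]
    linarith)
  rw [add_zero] at vert
  refine reflection_arith (y := yc Y) hA hK hG2 (by linarith) ?_
    (barrier_operator_le hα hκ hK.le hY0.le hYr hr1 hy0 hyr hκr) vert.2 pP pQ
  linarith [vert.1]

/-- No boundary touching point in the reflection argument. -/
theorem reflection_boundary {N : ℕ} {α : ℝ} {F : ℝ → ℝ} {v : Euc (N + 1) → ℝ}
    (hα : α ∈ Ioo (0 : ℝ) 1) (h : HalfSol N α F v) {X₀ Y : Euc (N + 1)} {r κ Λ K A m : ℝ}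
    (j : Fin N) (hr : 0 < r)
    (hle : ∀ t ∈ Ico 0 r, v (Y + t • bv (Fin.last N)) -
      v (hrefl j.castSucc (X₀ j.castSucc) Y + t • bv (Fin.last N)) ≤
        barrier α κ (rbar j X₀ A K r Y + m) K (yc X₀) t)
    (heq : v Y - v (hrefl j.castSucc (X₀ j.castSucc) Y) =
      barrier α κ (rbar j X₀ A K r Y + m) K (yc X₀) 0)
    (hpos : 0 < v Y - v (hrefl j.castSucc (X₀ j.castSucc) Y)) (hΛ : Λ < 2 * α * κ)
    (hF : |F (v Y) - F (v (hrefl j.castSucc (X₀ j.castSucc) Y))| ≤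
      Λ * |v Y - v (hrefl j.castSucc (X₀ j.castSucc) Y)|)
    (hY0 : yc Y = 0) : False := by
  set Q := hrefl j.castSucc (X₀ j.castSucc) Y with hQe
  have hQ0 : yc Q = 0 := by rw [hQe, yc_hrefl, hY0]
  set c := rbar j X₀ A K r Y + m
  have hlim := ((h.neumann Y hY0).sub (h.neumann Q hQ0)).sub (tendsto_barrier' hα κ c K (yc X₀))
  have hcZ : ∀ Z : Euc (N + 1), yc Z = 0 →
      ContinuousOn (fun t : ℝ => v (Z + t • bv (Fin.last N))) (Ico 0 r) := fun Z hZ =>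
    h.cont.comp (f := fun t : ℝ => Z + t • bv (Fin.last N)) (by fun_prop) fun t ht => by
      simpa [yc_add_last, hZ] using ht.1
  have hdZ : ∀ Z : Euc (N + 1), yc Z = 0 → ∀ t ∈ Ioo 0 r,
      HasDerivAt (fun t : ℝ => v (Z + t • bv (Fin.last N)))
        (fderiv ℝ v (Z + t • bv (Fin.last N)) (bv (Fin.last N))) t := fun Z hZ t ht =>
    hasDerivAt_comp_line ((h.smooth _ (by rw [yc_add_last, hZ]; linarith [ht.1])).differentiableAt
      (by simp))
  have hb0 : barrier α κ c K (yc X₀) 0 = c + K * yc X₀ ^ 4 := by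
    rw [barrier, Real.zero_rpow (mul_pos two_pos hα.1).ne']
    ring
  refine not_max_of_weighted_deriv_pos (a := 1 - 2 * α) hr
    (((hcZ Y hY0).sub (hcZ Q hQ0)).sub (continuous_barrier hα.1 κ c K (yc X₀)).continuousOn)
    (fun t ht => ((hdZ Y hY0 t ht).sub (hdZ Q hQ0 t ht)).sub
      (hasDerivAt_barrier α κ c K (yc X₀) ht.1)) (hlim.congr fun t => ?_) ?_ fun t ht => ?_
  · ring
  · rw [hb0] at heq
    rw [← heq]
    rw [abs_of_pos hpos] at hF
    have := (abs_le.1 hF).1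
    nlinarith
  · have := hle t ht
    simp only [Pi.sub_apply, zero_smul, add_zero]
    rw [heq]
    linarith

/-- Touching points of the comparison lie off the lateral and top faces. -/
theorem reflection_touch {N : ℕ} {X₀ Y : Euc (N + 1)} {r M K A : ℝ} (j : Fin N)
    (hr : 0 < r) (hr1 : r ≤ 1) (hy0 : 0 < yc X₀) (hyr : yc X₀ ≤ r / 2) (hK : 0 < K) (hA : 0 ≤ A)
    (hKr : 8 * M < K * r ^ 4) (hY : Y ∈ tbox X₀ r 0 r) (hYj : X₀ j.castSucc ≤ Y j.castSucc)
    (hφ : rbar j X₀ A K r Y + K * (yc Y ^ 2 - yc X₀ ^ 2) ^ 2 < 4 * M) :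
    (∀ i : Fin N, |Y i.castSucc - X₀ i.castSucc| < r) ∧ yc Y < r := by
  have hs1 : Y j.castSucc - X₀ j.castSucc ≤ r := (le_abs_self _).trans (hY.1 j)
  have htd := mul_nonneg hK.le (tdist_nonneg X₀ Y)
  have hyd := mul_nonneg hK.le (sq_nonneg (yc Y ^ 2 - yc X₀ ^ 2))
  have hss : 0 ≤ A * (2 * r * (Y j.castSucc - X₀ j.castSucc) -
      (Y j.castSucc - X₀ j.castSucc) ^ 2) := mul_nonneg hA (by nlinarith)
  have hr24 : r ^ 4 ≤ r ^ 2 := pow_le_pow_of_le_one hr.le hr1 (by norm_num)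
  have hKr2 : 8 * M < K * r ^ 2 := hKr.trans_le (mul_le_mul_of_nonneg_left hr24 hK.le)
  rw [rbar] at hφ
  constructor
  · refine fun i => lt_of_le_of_ne (hY.1 i) fun hh => ?_
    have h1 := mul_le_mul_of_nonneg_left (sq_le_tdist X₀ Y i) hK.le
    rw [← sq_abs, hh] at h1
    linarith
  · refine lt_of_le_of_ne hY.2.2 fun hh => ?_
    have h1 : 3 / 4 * r ^ 2 ≤ yc Y ^ 2 - yc X₀ ^ 2 := by rw [hh]; nlinarith
    have h2 : (3 / 4 * r ^ 2) ^ 2 ≤ (yc Y ^ 2 - yc X₀ ^ 2) ^ 2 :=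
      pow_le_pow_left₀ (by positivity) h1 2
    have h3 := mul_le_mul_of_nonneg_left h2 hK.le
    rw [show K * (3 / 4 * r ^ 2) ^ 2 = 9 / 16 * (K * r ^ 4) by ring] at h3
    linarith

/-- The odd part of `v` under a tangential reflection is controlled by an explicit barrier. -/
theorem reflection_comparison {N : ℕ} {α : ℝ} {F : ℝ → ℝ} {v : Euc (N + 1) → ℝ}
    (hα : α ∈ Ioo (0 : ℝ) 1) (h : HalfSol N α F v) {X₀ : Euc (N + 1)} {r κ Λ M K A : ℝ}
    (j : Fin N) (hr : 0 < r) (hr1 : r ≤ 1) (hy0 : 0 < yc X₀) (hyr : yc X₀ ≤ r / 2) (hκ : 0 ≤ κ)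
    (hκr : κ * r ^ (2 * α) ≤ 1 / 2) (hΛ : Λ < 2 * α * κ)
    (hF : ∀ a b : ℝ, |a| ≤ M → |b| ≤ M → |F a - F b| ≤ Λ * |a - b|)
    (hM : ∀ X ∈ tbox X₀ r 0 r, |v X| ≤ M) (hK : 0 < K) (hKr : 8 * M < K * r ^ 4)
    (hA : A = (N + 30) * K) {X : Euc (N + 1)} (hX : X ∈ tbox X₀ r 0 r)
    (hXj : X₀ j.castSucc ≤ X j.castSucc) :
    v X - v (hrefl j.castSucc (X₀ j.castSucc) X) ≤
      barrier α κ (rbar j X₀ A K r X) K (yc X₀) (yc X) := by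
  set R : Euc (N + 1) → Euc (N + 1) := hrefl j.castSucc (X₀ j.castSucc) with hR
  set G : Euc (N + 1) → ℝ := fun X => 1 - κ * yc X ^ (2 * α) with hG
  set φ : Euc (N + 1) → ℝ := fun X => rbar j X₀ A K r X + K * (yc X ^ 2 - yc X₀ ^ 2) ^ 2 with hφ
  set D : Set (Euc (N + 1)) := tbox X₀ r 0 r ∩ {X | X₀ j.castSucc ≤ X j.castSucc} with hD
  have hα2 : 0 < 2 * α := by linarith [hα.1]
  have hA0 : 0 ≤ A := by rw [hA]; positivity
  have hM0 : 0 ≤ M := (abs_nonneg _).trans (hM X hX)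
  have hRbox : ∀ Z ∈ tbox X₀ r 0 r, R Z ∈ tbox X₀ r 0 r := fun Z hZ => by
    refine ⟨fun i => ?_, by rw [hR, yc_hrefl]; exact hZ.2⟩
    by_cases hij : i = j
    · subst hij
      rw [hR, hrefl_apply_self]
      have := hZ.1 i
      rw [abs_le] at this ⊢
      constructor <;> linarith [this.1, this.2]
    · rw [hR, hrefl_apply_ne (by simpa using hij)]
      exact hZ.1 i
  have hGhalf : ∀ Z ∈ tbox X₀ r 0 r, 1 / 2 ≤ G Z := fun Z hZ => by
    have : κ * yc Z ^ (2 * α) ≤ κ * r ^ (2 * α) :=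
      mul_le_mul_of_nonneg_left (Real.rpow_le_rpow hZ.2.1 hZ.2.2 hα2.le) hκ
    simp only [hG]
    linarith
  have hGc : Continuous G :=
    continuous_const.sub (continuous_const.mul
      ((Real.continuous_rpow_const hα2.le).comp continuous_yc))
  have hφc : Continuous φ := by
    have h1 := continuous_rbar j X₀ A K r
    have h2 := continuous_yc (N := N)
    simp only [hφ]
    fun_prop
  have hvc : ContinuousOn v (tbox X₀ r 0 r) := h.cont.mono fun Z hZ => hZ.2.1
  have huc : ContinuousOn (fun Z => v Z - v (R Z)) D :=
    (hvc.mono inter_subset_left).sub (hvc.comp (continuous_hrefl _ _).continuousOn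
      fun Z hZ => hRbox Z hZ.1)
  have hΨc : ContinuousOn (fun Z => (v Z - v (R Z)) / G Z - φ Z) D :=
    (huc.div hGc.continuousOn fun Z hZ => by linarith [hGhalf Z hZ.1]).sub hφc.continuousOn
  have hDc : IsCompact D := (isCompact_tbox X₀ r 0 r).inter_right
    (isClosed_le continuous_const (by fun_prop))
  obtain ⟨Y, hY, hmax⟩ := hDc.exists_isMaxOn ⟨X, hX, hXj⟩ hΨc
  obtain ⟨m, hm⟩ : ∃ m, m = (v Y - v (R Y)) / G Y - φ Y := ⟨_, rfl⟩
  have hGY := hGhalf Y hY.1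
  have hYeq : v Y - v (R Y) = G Y * (φ Y + m) := by
    have : G Y ≠ 0 := by linarith
    rw [hm]
    field_simp
    ring
  have hle : ∀ Z ∈ D, v Z - v (R Z) ≤ G Z * (φ Z + m) := fun Z hZ => by
    have h1 := hmax hZ
    simp only [mem_ofPred_eq] at h1
    have h2 : (v Z - v (R Z)) / G Z ≤ φ Z + m := by linarith
    rw [div_le_iff₀ (by linarith [hGhalf Z hZ.1])] at h2
    linarith
  have hbar : ∀ Z m', G Z * (φ Z + m') =
      barrier α κ (rbar j X₀ A K r Z + m') K (yc X₀) (yc Z) := fun Z m' => by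
    simp only [hG, hφ, barrier]
    ring
  suffices hm0 : m ≤ 0 by
    have h1 := hle X ⟨hX, hXj⟩
    have h2 := hGhalf X hX
    have h3 : G X * (φ X + m) ≤ G X * (φ X + 0) :=
      mul_le_mul_of_nonneg_left (by linarith) (by linarith)
    rw [hbar X 0, add_zero] at h3
    exact h1.trans h3
  by_contra! hm0
  have hu2 : v Y - v (R Y) ≤ 2 * M := by
    have h1 := (abs_le.1 (hM _ hY.1)).2
    have h2 := (abs_le.1 (hM _ (hRbox _ hY.1))).1
    linarith
  have hφ0 : 0 ≤ φ Y := add_nonneg (rbar_nonneg hA0 hK.le hY.2 ((le_abs_self _).trans (hY.1.1 j)))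
    (mul_nonneg hK.le (sq_nonneg _))
  have hupos : 0 < v Y - v (R Y) := by
    rw [hYeq]
    exact mul_pos (by linarith) (by linarith)
  have hφ4 : φ Y < 4 * M := by
    have : 1 / 2 * (φ Y + m) ≤ G Y * (φ Y + m) :=
      mul_le_mul_of_nonneg_right hGY (by linarith)
    linarith
  have hs0 : X₀ j.castSucc < Y j.castSucc := by
    refine lt_of_le_of_ne hY.2 fun hh => ?_
    have : R Y = Y := by simp [hR, hrefl, hh]
    rw [this, sub_self] at hupos
    exact hupos.false
  obtain ⟨hYi, hYr⟩ := reflection_touch j hr hr1 hy0 hyr hK hA0 hKr hY.1 hY.2 hφ4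
  rw [hbar] at hYeq
  rcases hY.1.2.1.eq_or_lt with hy | hy
  · refine reflection_boundary hα h (m := m) (κ := κ) (K := K) (A := A) j hr (fun t ht => ?_) ?_
      hupos hΛ (hF _ _ (hM _ hY.1) (hM _ (hRbox _ hY.1))) hy.symm
    · have h1 := hle (Y + t • bv (Fin.last N)) ⟨⟨fun i => ?_, ?_⟩, ?_⟩
      · rw [hbar, rbar_add_last, yc_add_last, ← hy, zero_add] at h1
        rwa [← hrefl_line_ne (Fin.castSucc_lt_last j).ne']
      · rw [castSucc_add_last]; exact hY.1.1 i
      · rw [yc_add_last, ← hy, zero_add]; exact ⟨ht.1, ht.2.le⟩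
      · rw [mem_ofPred_eq, castSucc_add_last]; exact hY.2
    · rwa [← hy] at hYeq
  · refine reflection_interior hα h j hr1 hy0.le (by linarith) hκ hκr hK hA ?_ hYeq hy hYr.le
    filter_upwards [tbox_mem_nhds hYi hy hYr, ContinuousAt.eventually_lt
      (f := fun _ => X₀ j.castSucc) (g := fun Z : Euc (N + 1) => Z j.castSucc)
      continuousAt_const (by fun_prop) hs0] with Z hZ1 hZ2
    rw [← hbar]
    exact hle Z ⟨hZ1, hZ2.le⟩

/-- Tangential gradient bound up to the boundary. -/
theorem fderiv_castSucc_le {N : ℕ} {α : ℝ} {F : ℝ → ℝ} {v : Euc (N + 1) → ℝ}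
    (hα : α ∈ Ioo (0 : ℝ) 1) (h : HalfSol N α F v) {X₀ : Euc (N + 1)} {r κ Λ M : ℝ}
    (j : Fin N) (hr : 0 < r) (hr1 : r ≤ 1) (hy0 : 0 < yc X₀) (hyr : yc X₀ ≤ r / 2) (hκ : 0 ≤ κ)
    (hκr : κ * r ^ (2 * α) ≤ 1 / 2) (hΛ : Λ < 2 * α * κ)
    (hF : ∀ a b : ℝ, |a| ≤ M → |b| ≤ M → |F a - F b| ≤ Λ * |a - b|)
    (hM : ∀ X ∈ tbox X₀ r 0 r, |v X| ≤ M) :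
    fderiv ℝ v X₀ (bv j.castSucc) ≤ (N + 30) * (8 * M / r ^ 4 + 1) := by
  have hN0 : (0 : ℝ) ≤ N := N.cast_nonneg
  have hX₀ : X₀ ∈ tbox X₀ r 0 r := ⟨fun i => by simpa using hr.le, hy0.le, by linarith⟩
  have hM0 : 0 ≤ M := (abs_nonneg _).trans (hM X₀ hX₀)
  set K := 8 * M / r ^ 4 + 1 with hK
  have hK0 : 0 < K := by positivity
  have hKr : 8 * M < K * r ^ 4 := by
    rw [hK, add_mul, div_mul_cancel₀ _ (by positivity)]
    linarith [pow_pos hr 4]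
  set A := (N + 30) * K with hA
  have hAK : K ≤ A := by rw [hA]; nlinarith
  set e : Euc (N + 1) := bv j.castSucc with he
  have hline : ∀ t ∈ Ioo 0 r, v (X₀ + t • e) - v (X₀ + t • (-e)) ≤ 2 * A * r * t := fun t ht => by
    have h1 := reflection_comparison hα h j hr hr1 hy0 hyr hκ hκr hΛ hF hM hK0 hKr hA
      (X := X₀ + t • e) ⟨fun i => ?_, by rw [he, yc_add_castSucc]; exact hX₀.2⟩ ?_
    · have h0 : hrefl j.castSucc (X₀ j.castSucc) X₀ = X₀ := by simp [hrefl]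
      have h3 : tdist X₀ X₀ = 0 := by simp [tdist]
      have h4 : 0 ≤ κ * yc X₀ ^ (2 * α) := by positivity
      rw [he, hrefl_line_self, h0, rbar_add_castSucc_self, yc_add_castSucc, ← he, rbar, barrier,
        h3] at h1
      simp only [sub_self, mul_zero, sub_zero, zero_pow two_ne_zero, add_zero, zero_add] at h1
      have h5 : 0 ≤ 2 * A * r * t + (K - A) * t ^ 2 := by
        have h6 : 0 ≤ t * (A * (r - t) + A * r + K * t) :=
          mul_nonneg ht.1.le (add_nonneg (add_nonneg (mul_nonneg (by linarith)
            (by linarith [ht.2])) (mul_nonneg (by linarith) hr.le)) (mul_nonneg hK0.le ht.1.le))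
        linarith
      have h6 : (K - A) * t ^ 2 ≤ 0 := mul_nonpos_of_nonpos_of_nonneg (by linarith) (sq_nonneg t)
      have h7 := mul_nonneg h4 h5
      linarith
    · rw [he, castSucc_add_castSucc]
      split_ifs
      · rw [add_sub_cancel_left, abs_of_pos ht.1]; exact ht.2.le
      · simpa using hr.le
    · rw [he, castSucc_add_castSucc, if_pos rfl]
      linarith [ht.1]
  have hdv : DifferentiableAt ℝ v X₀ := (h.smooth X₀ hy0).differentiableAt (by simp)
  have hd : HasDerivAt (fun t : ℝ => v (X₀ + t • e) - v (X₀ + t • (-e)))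
      (2 * fderiv ℝ v X₀ e) 0 := by
    have h1 := hasDerivAt_comp_line (X := X₀) (e := e) (t := 0) (by simpa using hdv)
    have h2 := hasDerivAt_comp_line (X := X₀) (e := -e) (t := 0) (by simpa using hdv)
    refine (h1.sub h2).congr_deriv ?_
    simp only [zero_smul, add_zero, map_neg]
    ring
  have h1 := hasDerivAt_le_of_le_mul hr hd (by simp) hline
  nlinarith

theorem abs_fderiv_castSucc_le {N : ℕ} {α : ℝ} {F : ℝ → ℝ} {v : Euc (N + 1) → ℝ}
    (hα : α ∈ Ioo (0 : ℝ) 1) (h : HalfSol N α F v) {X₀ : Euc (N + 1)} {r κ Λ M : ℝ}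
    (j : Fin N) (hr : 0 < r) (hr1 : r ≤ 1) (hy0 : 0 < yc X₀) (hyr : yc X₀ ≤ r / 2) (hκ : 0 ≤ κ)
    (hκr : κ * r ^ (2 * α) ≤ 1 / 2) (hΛ : Λ < 2 * α * κ)
    (hF : ∀ a b : ℝ, |a| ≤ M → |b| ≤ M → |F a - F b| ≤ Λ * |a - b|)
    (hM : ∀ X ∈ tbox X₀ r 0 r, |v X| ≤ M) :
    |fderiv ℝ v X₀ (bv j.castSucc)| ≤ (N + 30) * (8 * M / r ^ 4 + 1) := by
  have h1 := fderiv_castSucc_le hα h j hr hr1 hy0 hyr hκ hκr hΛ hF hM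
  have h2 := fderiv_castSucc_le hα h.neg (M := M) (Λ := Λ) j hr hr1 hy0 hyr hκ hκr hΛ
    (fun a b ha hb => by
      have := hF (-b) (-a) (by rwa [abs_neg]) (by rwa [abs_neg])
      rw [show -F (-a) - -F (-b) = F (-b) - F (-a) by ring,
        show a - b = -b - -a by ring]
      exact this)
    (fun X hX => by rw [abs_neg]; exact hM X hX)
  rw [fderiv_fun_neg, neg_apply] at h2
  exact abs_le.2 ⟨by linarith, h1⟩

/-- Lipschitz continuity on bounded sets, for functions of one variable. -/
def LocLip (F : ℝ → ℝ) : Prop :=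
  ∀ M, ∃ Λ, 0 ≤ Λ ∧ ∀ a b : ℝ, |a| ≤ M → |b| ≤ M → |F a - F b| ≤ Λ * |a - b|

theorem locLip_neg_abs_rpow_mul {q : ℝ} (hq : 0 < q) : LocLip fun a => -(|a| ^ q * a) := by
  intro M
  have hpow : ∀ a b : ℝ, a ∈ Icc 0 M → b ∈ Icc 0 M →
      |a ^ (q + 1) - b ^ (q + 1)| ≤ (q + 1) * M ^ q * |a - b| := fun a b ha hb => by
    refine (convex_Icc 0 M).norm_image_sub_le_of_norm_hasDerivWithin_le
      (f := fun t : ℝ => t ^ (q + 1)) (f' := fun t => (q + 1) * t ^ (q + 1 - 1))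
      (fun t _ => (Real.hasDerivAt_rpow_const (Or.inr (by linarith))).hasDerivWithinAt)
      (fun t ht => ?_) hb ha
    rw [add_sub_cancel_right, Real.norm_of_nonneg (mul_nonneg (by linarith)
      (Real.rpow_nonneg ht.1 _))]
    exact mul_le_mul_of_nonneg_left (Real.rpow_le_rpow ht.1 ht.2 hq.le) (by linarith)
  have hdec : ∀ a : ℝ, |a| ^ q * a = (max a 0) ^ (q + 1) - (max (-a) 0) ^ (q + 1) := fun a => by
    have hq1 : q + 1 ≠ 0 := by linarith
    rcases le_total 0 a with h | h
    · rw [max_eq_left h, max_eq_right (by linarith), Real.zero_rpow hq1, abs_of_nonneg h,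
        Real.rpow_add_one' h hq1, sub_zero]
    · rw [max_eq_right h, max_eq_left (by linarith), Real.zero_rpow hq1, abs_of_nonpos h,
        Real.rpow_add_one' (by linarith) hq1]
      ring
  rcases lt_or_ge M 0 with hM | hM
  · exact ⟨0, le_rfl, fun a _ ha => absurd (abs_nonneg a) (by linarith)⟩
  refine ⟨2 * ((q + 1) * M ^ q), by positivity, fun a b ha hb => ?_⟩
  rw [abs_le] at ha hb
  have h1 := hpow (max a 0) (max b 0) ⟨le_max_right _ _, max_le ha.2 hM⟩
    ⟨le_max_right _ _, max_le hb.2 hM⟩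
  have h2 := hpow (max (-a) 0) (max (-b) 0) ⟨le_max_right _ _, max_le (by linarith) hM⟩
    ⟨le_max_right _ _, max_le (by linarith) hM⟩
  have e1 : |max a 0 - max b 0| ≤ |a - b| := abs_max_sub_max_le_abs a b 0
  have e2 : |max (-a) 0 - max (-b) 0| ≤ |a - b| := by
    refine (abs_max_sub_max_le_abs (-a) (-b) 0).trans (le_of_eq ?_)
    rw [show -a - -b = -(a - b) by ring, abs_neg]
  have hc : 0 ≤ (q + 1) * M ^ q := by positivity
  have e3 := mul_le_mul_of_nonneg_left e1 hc
  have e4 := mul_le_mul_of_nonneg_left e2 hc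
  beta_reduce
  rw [hdec a, hdec b]
  rw [abs_le] at h1 h2 ⊢
  constructor <;> linarith [h1.1, h1.2, h2.1, h2.2]

/-- Local tangential gradient bound near a boundary point. -/
theorem HalfSol.exists_tangential_bound {N : ℕ} {α : ℝ} {F : ℝ → ℝ} {v : Euc (N + 1) → ℝ}
    (hα : α ∈ Ioo (0 : ℝ) 1) (h : HalfSol N α F v) (hF : LocLip F) (Z : Euc (N + 1)) :
    ∃ C r, 0 < C ∧ 0 < r ∧ ∀ X ∈ tbox Z r 0 r, 0 < yc X →
      ∀ j : Fin N, |fderiv ℝ v X (bv j.castSucc)| ≤ C := by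
  obtain ⟨M, hM⟩ := (isCompact_tbox Z 2 0 1).exists_bound_of_continuousOn
    (h.cont.mono fun X hX => hX.2.1)
  obtain ⟨Λ, hΛ0, hΛ⟩ := hF (max M 0)
  have hα0 := hα.1
  set κ := (Λ + 1) / (2 * α) with hκ
  have hκ0 : 0 ≤ κ := by positivity
  have hκΛ : Λ < 2 * α * κ := by
    rw [hκ, mul_div_cancel₀ _ (by positivity)]
    linarith
  have h1 := (tendsto_rpow_nhdsGT_zero (p := 2 * α) (by linarith)).const_mul κ
  rw [mul_zero] at h1
  obtain ⟨r, hrκ, hr0, hr1⟩ := ((h1.eventually (gt_mem_nhds (show (0 : ℝ) < 1 / 2 by norm_num))).and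
    (Ioo_mem_nhdsGT zero_lt_one)).exists
  refine ⟨(N + 30) * (8 * max M 0 / r ^ 4 + 1), r / 2, by positivity, by linarith,
    fun X hX hX0 j => abs_fderiv_castSucc_le hα h j hr0 hr1.le hX0 hX.2.2 hκ0 hrκ.le hκΛ hΛ ?_⟩
  refine fun Y hY => (hM Y ⟨fun i => ?_, hY.2.1, hY.2.2.trans hr1.le⟩).trans (le_max_left _ _)
  have h2 := hX.1 i
  have h3 := hY.1 i
  rw [abs_le] at h2 h3 ⊢
  constructor <;> linarith [h2.1, h2.2, h3.1, h3.2]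

theorem abs_apply_le_norm {n : ℕ} (X : Euc n) (i : Fin n) : |X i| ≤ ‖X‖ := by
  simpa using PiLp.norm_apply_le X i

/-- A horizontal translate of `v` differs from `v` by at most the size of the translation. -/
theorem abs_sub_le_of_tangential_bound {N : ℕ} {v : Euc (N + 1) → ℝ} {X h : Euc (N + 1)}
    {C η : ℝ} (hC : 0 ≤ C) (hh : yc h = 0) (hη : ‖h‖ ≤ η)
    (hd : ∀ t ∈ Icc (0 : ℝ) 1, DifferentiableAt ℝ v (X + t • h) ∧
      ∀ j : Fin N, |fderiv ℝ v (X + t • h) (bv j.castSucc)| ≤ C) :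
    |v (X + h) - v X| ≤ N * C * η := by
  have h1 := norm_image_sub_le_of_norm_deriv_le_segment_01' (f := fun t : ℝ => v (X + t • h))
    (C := N * C * η) (fun t ht => (hasDerivAt_comp_line (hd t ht).1).hasDerivWithinAt)
    (fun t ht => ?_)
  · simpa using h1
  · have hh' : h (Fin.last N) = 0 := hh
    rw [map_eq_sum_bv, Fin.sum_univ_castSucc, hh', zero_smul, add_zero]
    calc _ ≤ ∑ i : Fin N, ‖h i.castSucc • fderiv ℝ v (X + t • h) (bv i.castSucc)‖ :=
          norm_sum_le _ _
      _ ≤ ∑ _i : Fin N, C * η := Finset.sum_le_sum fun i _ => by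
          rw [smul_eq_mul, Real.norm_eq_abs, abs_mul, mul_comm]
          exact mul_le_mul ((hd t ⟨ht.1, ht.2.le⟩).2 i) ((abs_apply_le_norm h _).trans hη)
            (abs_nonneg _) hC
      _ = _ := by simp; ring

theorem wlap_translate_sub {N : ℕ} (α : ℝ) {v : Euc (N + 1) → ℝ} {X h : Euc (N + 1)}
    (hh : yc h = 0) (hX : ContDiffAt ℝ 2 v X) (hXh : ContDiffAt ℝ 2 v (X + h)) :
    ContDiffAt ℝ 2 (fun Z => v (Z + h) - v Z) X ∧
      fderiv ℝ (fun Z => v (Z + h) - v Z) X = fderiv ℝ v (X + h) - fderiv ℝ v X ∧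
      wlap α (fun Z => v (Z + h) - v Z) X = wlap α v (X + h) - wlap α v X := by
  have h1 : ContDiffAt ℝ 2 (fun Z => v (Z + h)) X :=
    ContDiffAt.comp X hXh (by fun_prop : ContDiffAt ℝ 2 (fun Z => Z + h) X)
  have e0 : ∀ Z, ContDiffAt ℝ 2 (fun Z => v (Z + h)) Z → ContDiffAt ℝ 2 v Z →
      fderiv ℝ (fun Z => v (Z + h) - v Z) Z = fderiv ℝ v (Z + h) - fderiv ℝ v Z := fun Z a b => by
    rw [fderiv_fun_sub (a.differentiableAt (by simp)) (b.differentiableAt (by simp)),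
      fderiv_comp_add_right]
  have e1 : fderiv ℝ (fun Z => v (Z + h) - v Z) =ᶠ[𝓝 X]
      fun Z => fderiv ℝ v (Z + h) - fderiv ℝ v Z := by
    filter_upwards [h1.eventually (by simp), hX.eventually (by simp)] with Z a b using e0 Z a b
  have e2 : fderiv ℝ (fderiv ℝ (fun Z => v (Z + h) - v Z)) X =
      fderiv ℝ (fderiv ℝ v) (X + h) - fderiv ℝ (fderiv ℝ v) X := by
    rw [e1.fderiv_eq, fderiv_fun_sub _ hX.differentiableAt_fderiv_two, fderiv_comp_add_right]
    exact hXh.differentiableAt_fderiv_two.comp X (by fun_prop)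
  refine ⟨h1.sub hX, e0 X h1 hX, ?_⟩
  have hy : yc (X + h) = yc X := by
    have : yc (X + h) = yc X + yc h := rfl
    rw [this, hh, add_zero]
  simp only [wlap, e2, e0 X h1 hX, sub_apply, Finset.sum_sub_distrib, hy]
  ring

/-- The vertical derivative is stable under small horizontal translations near the boundary. -/
theorem HalfSol.exists_vertical_stability {N : ℕ} {α : ℝ} {F : ℝ → ℝ} {v : Euc (N + 1) → ℝ}
    (hα : α ∈ Ioo (0 : ℝ) 1) (h : HalfSol N α F v) (hF : LocLip F) (Z : Euc (N + 1)) :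
    ∃ C r, 0 < C ∧ 0 < r ∧ (∀ X ∈ tbox Z r 0 r, 0 < yc X →
        ∀ j : Fin N, |fderiv ℝ v X (bv j.castSucc)| ≤ C) ∧
      ∀ X ∈ tbox Z r 0 r, 0 < yc X → ∀ (k : Euc (N + 1)) (η : ℝ), yc k = 0 → ‖k‖ ≤ η → 0 < η →
        η ≤ r → |fderiv ℝ v (X + k) (bv (Fin.last N)) - fderiv ℝ v X (bv (Fin.last N))| ≤
          C * η / yc X := by
  obtain ⟨C, r, hC, hr, hb⟩ := h.exists_tangential_bound hα hF Z
  refine ⟨C + 16 * (N + 2) * (N + 1) * C, r / 3, by positivity, by positivity,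
    fun X hX hX0 j => (hb X ⟨fun i => (hX.1 i).trans (by linarith), hX.2.1,
      hX.2.2.trans (by linarith)⟩ hX0 j).trans (le_add_of_nonneg_right (by positivity)), ?_⟩
  intro X hX hX0 k η hk hkη hη hηr
  set ρ := yc X / 4 with hρ
  have hρ0 : 0 < ρ := by positivity
  have hyr := hX.2.2
  have hyk : ∀ Y : Euc (N + 1), ∀ t : ℝ, yc (Y + t • k) = yc Y := fun Y t => by
    have : yc (Y + t • k) = yc Y + t * yc k := rfl
    rw [this, hk, mul_zero, add_zero]
  have hY0 : ∀ Y ∈ tbox X ρ (2 * ρ) (5 * ρ), 0 < yc Y := fun Y hY => by linarith [hY.2.1]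
  have hY0k : ∀ Y ∈ tbox X ρ (2 * ρ) (5 * ρ), 0 < yc (Y + k) := fun Y hY => by
    have := hyk Y 1
    rw [one_smul] at this
    rw [this]
    exact hY0 Y hY
  have hw := fun Y (hY : Y ∈ tbox X ρ (2 * ρ) (5 * ρ)) =>
    wlap_translate_sub α hk (h.smooth Y (hY0 Y hY)) (h.smooth (Y + k) (hY0k Y hY))
  have hz : ∀ Y ∈ tbox X ρ (2 * ρ) (5 * ρ), wlap α (fun Z => v (Z + k) - v Z) Y = 0 :=
    fun Y hY => by
      rw [(hw Y hY).2.2, h.pde _ (hY0 Y hY), h.pde _ (hY0k Y hY), sub_zero]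
  have hsm : ∀ Y ∈ tbox X ρ (2 * ρ) (5 * ρ), |v (Y + k) - v Y| ≤ (N + 1) * C * η := fun Y hY => by
    refine (abs_sub_le_of_tangential_bound hC.le hk hkη fun t ht => ?_).trans ?_
    · have hp : 0 < yc (Y + t • k) := by rw [hyk]; exact hY0 Y hY
      refine ⟨(h.smooth _ hp).differentiableAt (by simp), hb _ ⟨fun i => ?_, hp.le, ?_⟩ hp⟩
      · have h1 := hX.1 i
        have h2 := hY.1 i
        have h3 : |t * k i.castSucc| ≤ η := by
          rw [abs_mul, abs_of_nonneg ht.1]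
          calc t * |k i.castSucc| ≤ 1 * η := mul_le_mul ht.2 ((abs_apply_le_norm k _).trans hkη)
                (abs_nonneg _) zero_le_one
            _ = η := one_mul η
        have h4 : (Y + t • k : Euc (N + 1)) i.castSucc = Y i.castSucc + t * k i.castSucc := rfl
        rw [h4]
        rw [abs_le] at h1 h2 h3 ⊢
        constructor <;> linarith [h1.1, h1.2, h2.1, h2.2, h3.1, h3.2]
      · rw [hyk]
        linarith [hY.2.2]
    · have : 0 ≤ C * η := by positivity
      linarith
  have hε : 0 < (N + 1) * C * η := by positivity
  have hXm : X ∈ tbox X ρ (2 * ρ) (5 * ρ) :=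
    ⟨fun i => by simpa using hρ0.le, by linarith, by linarith⟩
  have hy4 : yc X = 4 * ρ := by rw [hρ]; ring
  have up := fderiv_last_le hα hε hρ0 hy4 (fun Y hY => (hw Y hY).1) hz hsm
  have hneg : ∀ Y, fderiv ℝ (fun Z => -(v (Z + k) - v Z)) Y =
      -fderiv ℝ (fun Z => v (Z + k) - v Z) Y := fun Y => fderiv_fun_neg
  have dn := fderiv_last_le (α := α) (z := fun Z => -(v (Z + k) - v Z)) hα hε hρ0 hy4
    (fun Y hY => (hw Y hY).1.neg)
    (fun Y hY => by
      have := hz Y hY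
      rw [wlap] at this ⊢
      rw [show fderiv ℝ (fun Z => -(v (Z + k) - v Z)) =
        fun Y => -fderiv ℝ (fun Z => v (Z + k) - v Z) Y from funext hneg]
      rw [fderiv_fun_neg]
      simp only [neg_apply, Finset.sum_neg_distrib]
      linarith)
    (fun Y hY => by rw [abs_neg]; exact hsm Y hY)
  rw [hneg, neg_apply] at dn
  rw [(hw X hXm).2.1, sub_apply] at up dn
  have hle : 4 * (N + 2) * ((N + 1) * C * η) / ρ ≤
      (C + 16 * (N + 2) * (N + 1) * C) * η / yc X := by
    rw [hρ, show 4 * ((N : ℝ) + 2) * ((N + 1) * C * η) / (yc X / 4) =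
      (16 * (N + 2) * (N + 1) * C) * η / yc X by field_simp; ring]
    gcongr
    linarith
  exact abs_le.2 ⟨by linarith, by linarith⟩

theorem pt_castSucc {N : ℕ} (x : Euc N) (y : ℝ) (i : Fin N) : pt x y i.castSucc = x i := by
  simp [pt]

theorem pt_last {N : ℕ} (x : Euc N) (y : ℝ) : pt x y (Fin.last N) = y := by
  simp [pt]

theorem yc_pt {N : ℕ} (x : Euc N) (y : ℝ) : yc (pt x y) = y := pt_last x y

theorem ext_castSucc_last {N : ℕ} {X Y : Euc (N + 1)}
    (h : ∀ i : Fin N, X i.castSucc = Y i.castSucc) (hl : X (Fin.last N) = Y (Fin.last N)) :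
    X = Y := by
  ext i
  induction i using Fin.lastCases with
  | last => exact hl
  | cast i => exact h i

theorem pt_add_last {N : ℕ} (x : Euc N) (y t : ℝ) : pt x y + t • bv (Fin.last N) = pt x (y + t) :=
  ext_castSucc_last (fun i => by rw [castSucc_add_last, pt_castSucc, pt_castSucc])
    (by simp [pt_last])

theorem smul_pt {N : ℕ} (c : ℝ) (x : Euc N) (y : ℝ) : c • pt x y = pt (c • x) (c * y) :=
  ext_castSucc_last (fun i => by simp [pt_castSucc]) (by simp [pt_last])

theorem pt_add_pt {N : ℕ} (x x' : Euc N) (y y' : ℝ) : pt x y + pt x' y' = pt (x + x') (y + y') :=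
  ext_castSucc_last (fun i => by simp [pt_castSucc]) (by simp [pt_last])

theorem pt_xc {N : ℕ} (X : Euc (N + 1)) : pt (xc X) (yc X) = X :=
  ext_castSucc_last (fun i => by simp [pt_castSucc, xc]) (by simp [pt_last, yc])

theorem norm_pt_sq {N : ℕ} (x : Euc N) (y : ℝ) : ‖pt x y‖ ^ 2 = ‖x‖ ^ 2 + y ^ 2 := by
  rw [EuclideanSpace.norm_sq_eq, EuclideanSpace.norm_sq_eq, Fin.sum_univ_castSucc]
  simp [pt_castSucc, pt_last]

theorem norm_pt_zero {N : ℕ} (x : Euc N) : ‖pt x 0‖ = ‖x‖ := by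
  have h := norm_pt_sq x 0
  rw [zero_pow two_ne_zero, add_zero] at h
  exact (pow_left_inj₀ (norm_nonneg _) (norm_nonneg _) two_ne_zero).1 h

theorem continuous_pt {N : ℕ} : Continuous fun p : Euc N × ℝ => pt p.1 p.2 := by
  refine (PiLp.continuous_toLp 2 _).comp (continuous_pi fun i => ?_)
  induction i using Fin.lastCases with
  | last => simpa using continuous_snd
  | cast i =>
    simp only [Fin.snoc_castSucc]
    exact (by fun_prop : Continuous fun p : Euc N × ℝ => p.1 i)

theorem halfSol_of_neumannLim {N : ℕ} {α : ℝ} {F : ℝ → ℝ} {v : Euc (N + 1) → ℝ}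
    (hc : ContinuousOn v {X | 0 ≤ yc X}) (hsm : ContDiffOn ℝ 2 v (upperHalf N))
    (hpde : ∀ X ∈ upperHalf N, dvg (wgrad α v) X = 0)
    (hneu : ∀ x : Euc N, NeumannLim α v x (F (v (pt x 0)))) : HalfSol N α F v where
  cont := hc
  smooth X hX := hsm.contDiffAt ((isOpen_upperHalf N).mem_nhds hX)
  pde X hX := by
    have h := hpde X hX
    rw [dvg_wgrad_eq α (hsm.contDiffAt ((isOpen_upperHalf N).mem_nhds hX)) hX] at h
    exact (mul_eq_zero.1 h).resolve_left (Real.rpow_pos_of_pos hX _).ne'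
  neumann X hX := by
    have h := hneu (xc X)
    rw [← pt_xc X, hX]
    simp only [pt_add_last, zero_add]
    exact h

theorem HalfSol.dvg_kelvin_eq_zero {N : ℕ} {α : ℝ} {F : ℝ → ℝ} {v : Euc (N + 1) → ℝ}
    (h : HalfSol N α F v) {X : Euc (N + 1)} (hX : 0 < yc X) :
    dvg (wgrad α (kelvin N α v)) X = 0 := by
  have hX0 := ne_zero_of_yc_pos hX
  have hY : 0 < yc ((‖X‖ ^ 2)⁻¹ • X) := by
    have : yc ((‖X‖ ^ 2)⁻¹ • X) = (‖X‖ ^ 2)⁻¹ * yc X := rfl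
    rw [this]
    positivity
  rw [dvg_wgrad_eq α (contDiffAt_kelvin α hX0 (h.smooth _ hY)) hX,
    wlap_kelvin α hX (h.smooth _ hY) (h.pde _ hY), mul_zero]

/-- The weighted normal and tangential derivatives along a curve hitting the boundary with
tangential deviation `O(y²)`. -/
theorem HalfSol.tendsto_along_curve {N : ℕ} {α : ℝ} {F : ℝ → ℝ} {v : Euc (N + 1) → ℝ}
    (hα : α ∈ Ioo (0 : ℝ) 1) (h : HalfSol N α F v) (hF : LocLip F) (z : Euc N) {c : ℝ} (hc : 0 < c)
    {ξ : ℝ → Euc N} {τ : ℝ → ℝ} (hτ : Tendsto τ (𝓝[>] 0) (𝓝[>] 0))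
    (hξ : ∀ᶠ y in 𝓝[>] 0, ‖ξ y‖ ≤ c * τ y ^ 2) (k : Euc N) :
    Tendsto (fun y => τ y ^ (1 - 2 * α) *
        fderiv ℝ v (pt (z + ξ y) (τ y)) (bv (Fin.last N))) (𝓝[>] 0) (𝓝 (F (v (pt z 0)))) ∧
      Tendsto (fun y => τ y ^ (2 - 2 * α) * fderiv ℝ v (pt (z + ξ y) (τ y)) (pt k 0))
        (𝓝[>] 0) (𝓝 0) := by
  obtain ⟨C, r, hC, hr, hb, hs⟩ := h.exists_vertical_stability hα hF (pt z 0)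
  have hpow := (tendsto_rpow_nhdsGT_zero (p := 2 - 2 * α) (by linarith [hα.2])).comp hτ
  have hτ0 : Tendsto τ (𝓝[>] 0) (𝓝 0) := hτ.mono_right nhdsWithin_le_nhds
  have hτpos : ∀ᶠ y in 𝓝[>] 0, 0 < τ y := hτ.eventually self_mem_nhdsWithin
  have hτr : ∀ᶠ y in 𝓝[>] 0, τ y < r := hτ0.eventually_lt_const hr
  have hτc : ∀ᶠ y in 𝓝[>] 0, c * τ y ^ 2 < r :=
    (((hτ0.pow 2).const_mul c).congr fun _ => rfl).eventually_lt_const (by simpa using hr)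
  have hdec : ∀ y, pt (z + ξ y) (τ y) = pt z (τ y) + pt (ξ y) 0 := fun y => by
    rw [pt_add_pt, add_zero]
  constructor
  · have h1 := (h.neumann (pt z 0) (yc_pt z 0)).comp hτ
    simp only [pt_add_last, zero_add, Function.comp_def] at h1
    have h2 : Tendsto (fun y => τ y ^ (1 - 2 * α) *
        fderiv ℝ v (pt (z + ξ y) (τ y)) (bv (Fin.last N)) - τ y ^ (1 - 2 * α) *
        fderiv ℝ v (pt z (τ y)) (bv (Fin.last N))) (𝓝[>] 0) (𝓝 0) := by
      refine squeeze_zero_norm' (a := fun y => C * c * τ y ^ (2 - 2 * α)) ?_ ?_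
      · filter_upwards [hτpos, hτr, hτc, hξ] with y h0 hyr hyc hy
        have h3 := hs (pt z (τ y)) ⟨fun i => by simpa [pt_castSucc] using hr.le, by
          rw [yc_pt]; exact ⟨h0.le, hyr.le⟩⟩ (by rwa [yc_pt]) (pt (ξ y) 0) (c * τ y ^ 2)
          (yc_pt _ _) (by rwa [norm_pt_zero]) (by positivity) hyc.le
        rw [← hdec, yc_pt] at h3
        rw [← mul_sub, norm_mul, Real.norm_of_nonneg (by positivity), Real.norm_eq_abs]
        calc _ ≤ τ y ^ (1 - 2 * α) * (C * (c * τ y ^ 2) / τ y) := by gcongr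
          _ = C * c * (τ y ^ (1 - 2 * α) * τ y) := by field_simp
          _ = _ := by
            rw [← Real.rpow_add_one h0.ne']
            ring_nf
      · simpa [Function.comp_def] using hpow.const_mul (C * c)
    simpa using h2.add h1
  · refine squeeze_zero_norm' (a := fun y => τ y ^ (2 - 2 * α) * (∑ i, |k i| * C)) ?_ ?_
    · filter_upwards [hτpos, hτr, hτc, hξ] with y h0 hyr hyc hy
      rw [norm_mul, Real.norm_of_nonneg (by positivity)]
      refine mul_le_mul_of_nonneg_left ?_ (by positivity)
      rw [map_eq_sum_bv, Fin.sum_univ_castSucc, pt_last, zero_smul, add_zero]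
      refine (norm_sum_le _ _).trans (Finset.sum_le_sum fun i _ => ?_)
      rw [pt_castSucc, smul_eq_mul, Real.norm_eq_abs, abs_mul]
      refine mul_le_mul_of_nonneg_left (hb _ ⟨fun i => ?_, ?_⟩ (by rwa [yc_pt]) i) (abs_nonneg _)
      · rw [pt_castSucc, pt_castSucc, PiLp.add_apply, add_sub_cancel_left]
        exact (abs_apply_le_norm _ _).trans (hy.trans hyc.le)
      · rw [yc_pt]
        exact ⟨h0.le, hyr.le⟩
    · simpa [Function.comp_def] using hpow.mul_const (∑ i, |k i| * C)

theorem HalfSol.neumannLim_kelvin {N : ℕ} {α : ℝ} {F : ℝ → ℝ} {v : Euc (N + 1) → ℝ}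
    (hα : α ∈ Ioo (0 : ℝ) 1) (h : HalfSol N α F v) (hF : LocLip F) {x : Euc N} (hx : x ≠ 0) :
    NeumannLim α (kelvin N α v) x ((‖x‖ ^ 2) ^ (-((N : ℝ) - 2 * α) / 2) / ‖x‖ ^ 2 *
      (‖x‖ ^ 2) ^ (1 - 2 * α) * F (v (pt ((‖x‖ ^ 2)⁻¹ • x) 0))) := by
  obtain ⟨m, hm⟩ : ∃ m, m = (N : ℝ) - 2 * α := ⟨_, rfl⟩
  have hn0 : 0 < ‖x‖ ^ 2 := by positivity
  set n₀ := ‖x‖ ^ 2 with hn₀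
  set n : ℝ → ℝ := fun y => n₀ + y ^ 2 with hn
  have hnpos : ∀ y, 0 < n y := fun y => by positivity
  have hid : Tendsto (fun y : ℝ => y) (𝓝[>] 0) (𝓝 0) := nhdsWithin_le_nhds
  have hnlim : Tendsto n (𝓝[>] 0) (𝓝 n₀) := by simpa using (hid.pow 2).const_add n₀
  have hninv := hnlim.inv₀ hn0.ne'
  have hτ0 : Tendsto (fun y => (n y)⁻¹ * y) (𝓝[>] 0) (𝓝 0) := by simpa using hninv.mul hid
  have hτ : Tendsto (fun y => (n y)⁻¹ * y) (𝓝[>] 0) (𝓝[>] 0) := by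
    refine tendsto_nhdsWithin_iff.2 ⟨hτ0, ?_⟩
    filter_upwards [self_mem_nhdsWithin] with y hy
    exact mul_pos (inv_pos.2 (hnpos y)) hy
  have hξ : ∀ᶠ y in 𝓝[>] 0, ‖((n y)⁻¹ - n₀⁻¹) • x‖ ≤
      (2 * ‖x‖) * ((n y)⁻¹ * y) ^ 2 := by
    filter_upwards [hnlim.eventually_lt_const (show n₀ < 2 * n₀ by linarith)] with y hy
    have hny := hnpos y
    have e1 : (n y)⁻¹ - n₀⁻¹ = -(y ^ 2 / (n y * n₀)) := by
      simp only [hn] at hny ⊢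
      field_simp
      ring
    rw [norm_smul, e1, norm_neg, Real.norm_of_nonneg (by positivity), mul_pow, mul_comm 2 ‖x‖,
      mul_assoc, mul_comm]
    refine mul_le_mul_of_nonneg_left ?_ (norm_nonneg x)
    rw [div_le_iff₀ (by positivity)]
    have : 2 * ((n y)⁻¹ ^ 2 * y ^ 2) * (n y * n₀) = y ^ 2 * (2 * n₀ / n y) := by field_simp
    rw [this]
    exact le_mul_of_one_le_right (sq_nonneg y) ((one_le_div hny).2 hy.le)
  obtain ⟨T1, T2⟩ := h.tendsto_along_curve hα hF (n₀⁻¹ • x) (c := 2 * ‖x‖) (by positivity) hτ hξ x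
  have hpt : ∀ y, pt (n₀⁻¹ • x + ((n y)⁻¹ - n₀⁻¹) • x) ((n y)⁻¹ * y) =
      (n y)⁻¹ • pt x y := fun y => by
    rw [smul_pt, ← add_smul]
    ring_nf
  simp only [hpt] at T1 T2
  have hv : Tendsto (fun y => v ((n y)⁻¹ • pt x y)) (𝓝[>] 0) (𝓝 (v (pt (n₀⁻¹ • x) 0))) := by
    have h1 : ContinuousWithinAt v {X | 0 ≤ yc X} (pt (n₀⁻¹ • x) 0) :=
      h.cont _ (by simp [yc_pt])
    refine h1.tendsto.comp (tendsto_nhdsWithin_iff.2 ⟨?_, ?_⟩)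
    · have h2 : Tendsto (fun y => ((n y)⁻¹ • x, (n y)⁻¹ * y)) (𝓝[>] 0) (𝓝 (n₀⁻¹ • x, (0 : ℝ))) :=
        (hninv.smul_const x).prodMk_nhds hτ0
      simpa only [smul_pt, Function.comp_def] using
        (continuous_pt.tendsto (n₀⁻¹ • x, (0 : ℝ))).comp h2
    · filter_upwards [self_mem_nhdsWithin] with y hy
      rw [smul_pt, yc_pt]
      exact mul_nonneg (inv_pos.2 (hnpos y)).le (le_of_lt hy)
  have hP := hnlim.rpow_const (p := -m / 2) (Or.inl hn0.ne')
  have hna := hnlim.rpow_const (p := 1 - 2 * α) (Or.inl hn0.ne')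
  have hya := tendsto_rpow_nhdsGT_zero (p := 2 - 2 * α) (by linarith [hα.2])
  have hPn := hP.div hnlim hn0.ne'
  have L1 := ((hPn.mul hv).mul hya).const_mul (-m)
  have L2 := ((hPn.mul hna).mul (((hid.pow 2).div hnlim hn0.ne').const_mul 2 |>.const_sub 1)).mul T1
  have L3 := ((hPn.mul hna).mul T2).const_mul (-2)
  have L := (L1.add L2).add L3
  simp only [mul_zero, zero_add, add_zero, zero_pow two_ne_zero, zero_div, sub_zero, mul_one,
    Pi.div_apply] at L
  rw [← hm]
  refine L.congr' ?_
  filter_upwards [self_mem_nhdsWithin] with y hy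
  have hy : 0 < y := hy
  have hny := hnpos y
  have hX : n y = ‖pt x y‖ ^ 2 := (norm_pt_sq x y).symm
  have hw : 0 < yc ((n y)⁻¹ • pt x y) := by rw [smul_pt, yc_pt]; positivity
  have hsm := h.smooth _ hw
  have hk := contDiffAt_kelvin α (ne_zero_of_yc_pos (by rwa [yc_pt] : 0 < yc (pt x y)))
    (by rwa [← hX])
  have hd := fderiv_kelvin α (pt x y) (Fin.last N) hX hny hm rfl (hk.differentiableAt (by simp))
    (hsm.differentiableAt (by simp))
  have hsplit : pt x y = pt x 0 + y • bv (Fin.last N) := by rw [pt_add_last, zero_add]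
  have hya1 : y ^ (2 - 2 * α) = y ^ (1 - 2 * α) * y := by
    rw [← Real.rpow_add_one hy.ne']; ring_nf
  have hτ1 : ((n y)⁻¹ * y) ^ (1 - 2 * α) = (n y ^ (1 - 2 * α))⁻¹ * y ^ (1 - 2 * α) := by
    rw [Real.mul_rpow (by positivity) hy.le, Real.inv_rpow hny.le]
  have hτ2 : ((n y)⁻¹ * y) ^ (2 - 2 * α) =
      (n y ^ (1 - 2 * α))⁻¹ * y ^ (1 - 2 * α) * ((n y)⁻¹ * y) := by
    rw [← hτ1, ← Real.rpow_add_one (by positivity)]; ring_nf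
  rw [hd, pt_last, hya1, hτ1, hτ2]
  have hD : fderiv ℝ v ((n y)⁻¹ • pt x y) ((n y)⁻¹ • bv (Fin.last N) - (2 * y / n y ^ 2) • pt x y) =
      ((n y)⁻¹ - 2 * y ^ 2 / n y ^ 2) * fderiv ℝ v ((n y)⁻¹ • pt x y) (bv (Fin.last N)) -
        2 * y / n y ^ 2 * fderiv ℝ v ((n y)⁻¹ • pt x y) (pt x 0) := by
    conv_lhs => rw [map_sub, map_smul, map_smul]; arg 2; arg 2; arg 2; rw [hsplit]
    rw [map_add, map_smul]
    simp only [smul_eq_mul]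
    ring
  rw [hD]
  have hna0 : n y ^ (1 - 2 * α) ≠ 0 := (Real.rpow_pos_of_pos hny _).ne'
  field_simp
  ring

/-- Scaling of the critical nonlinearity under the Kelvin weight. -/
theorem kelvin_weight_nonlinearity {N : ℕ} {α : ℝ} (hN : 2 * α < (N : ℝ)) {n : ℝ} (hn : 0 < n)
    (a : ℝ) :
    n ^ (-((N : ℝ) - 2 * α) / 2) / n * n ^ (1 - 2 * α) * -(|a| ^ (critExp N α - 2) * a) =
      -(|n ^ (-((N : ℝ) - 2 * α) / 2) * a| ^ (critExp N α - 2) *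
        (n ^ (-((N : ℝ) - 2 * α) / 2) * a)) := by
  have hm : (N : ℝ) - 2 * α ≠ 0 := by linarith
  have hP : 0 < n ^ (-((N : ℝ) - 2 * α) / 2) := Real.rpow_pos_of_pos hn _
  rw [abs_mul, abs_of_pos hP, Real.mul_rpow hP.le (abs_nonneg a), ← Real.rpow_mul hn.le,
    show -((N : ℝ) - 2 * α) / 2 * (critExp N α - 2) = 1 - 2 * α - 1 by
      rw [critExp]; field_simp; ring,
    Real.rpow_sub_one hn.ne']
  ring

/-- the Kelvin transform of a solution of the critical half-space problem
solves the same problem away from the origin. -/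
theorem kelvin_transform_solves
    (N : ℕ) (α : ℝ) (hα : α ∈ Set.Ioo (0 : ℝ) 1) (hN : 2 * α < (N : ℝ))
    (v : Euc (N + 1) → ℝ)
    (hc : ContinuousOn v {X | 0 ≤ yc X})
    (hsm : ContDiffOn ℝ 2 v (upperHalf N))
    (hpde : ∀ X ∈ upperHalf N, dvg (wgrad α v) X = 0)
    (hneu : ∀ x : Euc N,
      NeumannLim α v x (-(|v (pt x 0)| ^ (critExp N α - 2) * v (pt x 0)))) :
    (∀ X ∈ upperHalf N, X ≠ 0 → dvg (wgrad α (kelvin N α v)) X = 0) ∧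
      (∀ x : Euc N, x ≠ 0 →
        NeumannLim α (kelvin N α v) x
          (-(|kelvin N α v (pt x 0)| ^ (critExp N α - 2) * kelvin N α v (pt x 0)))) := by
  set F : ℝ → ℝ := fun a => -(|a| ^ (critExp N α - 2) * a) with hF
  have h : HalfSol N α F v := halfSol_of_neumannLim hc hsm hpde hneu
  have hm : 0 < (N : ℝ) - 2 * α := by linarith
  have hq : 0 < critExp N α - 2 := by
    have : critExp N α - 2 = 4 * α / (N - 2 * α) := by rw [critExp]; field_simp; ring
    rw [this]
    exact div_pos (by linarith [hα.1]) hm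
  refine ⟨fun X hX _ => h.dvg_kelvin_eq_zero hX, fun x hx => ?_⟩
  have hlim := h.neumannLim_kelvin hα (locLip_neg_abs_rpow_mul hq) hx
  rw [hF, kelvin_weight_nonlinearity hN (by positivity)] at hlim
  rwa [kelvin_eq, norm_pt_zero, smul_pt, mul_zero]

end
end
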